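/- For every M > 0, the set K_M of symmetric nonnegative trace-class operators ρ on L²(ℝ) satisfying Tr ρ = 1 and Tr(XρX) + Tr((i∇)ρ(i∇)) ≤ M is compact in the trace-class norm. -/

import Mathlib

open MeasureTheory ENNReal Complex

noncomputable def approxNum {H : Type*} [NormedAddCommGroup H] [NormedSpace ℂ H]
    (T : H →L[ℂ] H) (n : ℕ) : ℝ :=
  sInf ((fun F : H →L[ℂ] H => ‖T - F‖) ''
    {F | Module.rank ℂ (LinearMap.range (F : H →ₗ[ℂ] H)) ≤ n})

/-- The Schatten `p`-norm, defined through the approximation numbers (which agree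
with the singular values for operators on a Hilbert space). -/
noncomputable def schattenNorm {H : Type*} [NormedAddCommGroup H] [NormedSpace ℂ H]
    (p : ℝ≥0∞) (T : H →L[ℂ] H) : ℝ≥0∞ :=
  if p = ∞ then ENNReal.ofReal ‖T‖
  else (∑' n, ENNReal.ofReal (approxNum T n) ^ p.toReal) ^ (1 / p.toReal)

/-- The rank one operator `|φ⟩⟨ψ| : χ ↦ ⟨ψ, χ⟩ φ`. -/
noncomputable def rankOne {H : Type*} [NormedAddCommGroup H] [InnerProductSpace ℂ H]
    (φ ψ : H) : H →L[ℂ] H := (innerSL ℂ ψ).smulRight φ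


/-- `g` is the weak (distributional) derivative of `ψ`. -/
def HasWeakDeriv (ψ g : ℝ → ℂ) : Prop :=
  ∀ φ : ℝ → ℝ, ContDiff ℝ (⊤ : ℕ∞) φ → HasCompactSupport φ →
    (∫ x : ℝ, ψ x * Complex.ofReal (deriv φ x)) = -∫ x : ℝ, g x * Complex.ofReal (φ x)

/-- The set `K_M` of symmetric nonnegative trace-class operators
`ρ = ∑ⱼ λⱼ|ψⱼ⟩⟨ψⱼ|` on `L²(ℝ)` with `Tr ρ = 1` and
`Tr(XρX) + Tr((i∇)ρ(i∇)) = ∑ⱼ λⱼ (‖Xψⱼ‖₂² + ‖∇ψⱼ‖₂²) ≤ M`. -/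
def KM (M : ℝ) :
    Set (Lp ℂ 2 (volume : Measure ℝ) →L[ℂ] Lp ℂ 2 (volume : Measure ℝ)) :=
  {ρ | ∃ (lam : ℕ → ℝ) (e : ℕ → Lp ℂ 2 (volume : Measure ℝ)),
    (∀ j, 0 ≤ lam j) ∧ Orthonormal ℂ e ∧ HasSum lam 1 ∧
    ρ = (∑' j, lam j • rankOne (e j) (e j)) ∧
    ∃ ψ g : ℕ → ℝ → ℂ, (∀ j, (e j : ℝ → ℂ) =ᵐ[volume] ψ j) ∧
      (∀ j, HasWeakDeriv (ψ j) (g j)) ∧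
      (∑' j, ENNReal.ofReal (lam j) *
        ((∫⁻ x : ℝ, ENNReal.ofReal (x ^ 2 * ‖ψ j x‖ ^ 2))
          + ∫⁻ x : ℝ, ENNReal.ofReal (‖g j x‖ ^ 2))) ≤ ENNReal.ofReal M}

section Schatten

variable {H : Type*} [NormedAddCommGroup H] [NormedSpace ℂ H]

lemma approxNum_bddBelow (T : H →L[ℂ] H) (n : ℕ) :
    BddBelow ((fun F : H →L[ℂ] H => ‖T - F‖) ''
      {F | Module.rank ℂ (LinearMap.range (F : H →ₗ[ℂ] H)) ≤ n}) :=
  ⟨0, by rintro _ ⟨F, -, rfl⟩; exact norm_nonneg _⟩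

lemma approxNum_nonempty (T : H →L[ℂ] H) (n : ℕ) :
    ((fun F : H →L[ℂ] H => ‖T - F‖) ''
      {F | Module.rank ℂ (LinearMap.range (F : H →ₗ[ℂ] H)) ≤ n}).Nonempty :=
  ⟨_, 0, by simp, rfl⟩

lemma approxNum_nonneg (T : H →L[ℂ] H) (n : ℕ) : 0 ≤ approxNum T n :=
  Real.sInf_nonneg (by rintro _ ⟨F, -, rfl⟩; exact norm_nonneg _)

lemma approxNum_le_norm_sub (T F : H →L[ℂ] H) {n : ℕ}
    (hF : LinearMap.rank (F : H →ₗ[ℂ] H) ≤ n) : approxNum T n ≤ ‖T - F‖ :=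
  csInf_le (approxNum_bddBelow T n) ⟨F, hF, rfl⟩

lemma approxNum_antitone (T : H →L[ℂ] H) : Antitone (approxNum T) := fun m n hmn =>
  csInf_le_csInf (approxNum_bddBelow T n) (approxNum_nonempty T m)
    (Set.image_mono fun _ hF => le_trans (Set.mem_ofPred.1 hF) (by exact_mod_cast hmn))

lemma approxNum_le_norm (T : H →L[ℂ] H) (n : ℕ) : approxNum T n ≤ ‖T‖ := by
  simpa using approxNum_le_norm_sub T 0 (n := n) (by simp)

lemma rank_sub_le {F G : H →L[ℂ] H} {m n : ℕ} (hF : LinearMap.rank (F : H →ₗ[ℂ] H) ≤ m)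
    (hG : LinearMap.rank (G : H →ₗ[ℂ] H) ≤ n) :
    LinearMap.rank ((F - G : H →L[ℂ] H) : H →ₗ[ℂ] H) ≤ (m + n : ℕ) := by
  have hneg : LinearMap.rank (-(G : H →ₗ[ℂ] H)) ≤ n := by
    rw [LinearMap.rank, LinearMap.range_neg]
    exact hG
  have h := LinearMap.rank_add_le (F : H →ₗ[ℂ] H) (-(G : H →ₗ[ℂ] H))
  rw [ContinuousLinearMap.toLinearMap_sub, sub_eq_add_neg]
  push_cast
  exact h.trans (add_le_add hF hneg)

lemma approxNum_sub_le (A B : H →L[ℂ] H) (m n : ℕ) :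
    approxNum (A - B) (m + n) ≤ approxNum A m + approxNum B n := by
  refine le_of_forall_pos_le_add fun ε hε => ?_
  obtain ⟨_, ⟨F, hF, rfl⟩, hF'⟩ := exists_lt_of_csInf_lt (approxNum_nonempty A m)
    (show approxNum A m < approxNum A m + ε / 2 by linarith)
  obtain ⟨_, ⟨G, hG, rfl⟩, hG'⟩ := exists_lt_of_csInf_lt (approxNum_nonempty B n)
    (show approxNum B n < approxNum B n + ε / 2 by linarith)
  have h1 := approxNum_le_norm_sub (A - B) (F - G) (rank_sub_le hF hG)
  have h2 : ‖A - B - (F - G)‖ ≤ ‖A - F‖ + ‖B - G‖ := by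
    rw [show A - B - (F - G) = (A - F) - (B - G) by abel]
    exact norm_sub_le _ _
  simp only at hF' hG'
  linarith

lemma schattenNorm_one (T : H →L[ℂ] H) :
    schattenNorm 1 T = ∑' n, ENNReal.ofReal (approxNum T n) := by
  simp [schattenNorm]

lemma schattenNorm_one_sub_le (A B : H →L[ℂ] H) :
    schattenNorm 1 (A - B) ≤ 2 * (schattenNorm 1 A + schattenNorm 1 B) := by
  simp only [schattenNorm_one]
  rw [← tsum_even_add_odd (f := fun n => ENNReal.ofReal (approxNum (A - B) n))
    ENNReal.summable ENNReal.summable, two_mul,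
    ← ENNReal.tsum_add (f := fun n => ENNReal.ofReal (approxNum A n))]
  have key (k : ℕ) : ENNReal.ofReal (approxNum (A - B) (k + k)) ≤
      ENNReal.ofReal (approxNum A k) + ENNReal.ofReal (approxNum B k) := by
    rw [← ENNReal.ofReal_add (approxNum_nonneg _ _) (approxNum_nonneg _ _)]
    exact ENNReal.ofReal_le_ofReal (approxNum_sub_le A B k k)
  refine add_le_add (ENNReal.tsum_le_tsum fun k => ?_) (ENNReal.tsum_le_tsum fun k => ?_)
  · rw [two_mul]
    exact key k
  · refine le_trans (ENNReal.ofReal_le_ofReal (approxNum_antitone _ ?_)) (key k)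
    omega

lemma schattenNorm_one_le_of_rank_le (T : H →L[ℂ] H) {r : ℕ}
    (hT : LinearMap.rank (T : H →ₗ[ℂ] H) ≤ r) :
    schattenNorm 1 T ≤ r * ENNReal.ofReal ‖T‖ := by
  rw [schattenNorm_one, tsum_eq_sum (s := Finset.range r)]
  · refine (Finset.sum_le_card_nsmul _ _ (ENNReal.ofReal ‖T‖) fun n _ =>
      ENNReal.ofReal_le_ofReal (approxNum_le_norm T n)).trans ?_
    simp
  · intro n hn
    have hrn : r ≤ n := by simpa using hn
    have := approxNum_le_norm_sub T T (hT.trans (by exact_mod_cast hrn) : _ ≤ (n : Cardinal))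
    simpa using this

end Schatten

section RankOne

variable {H : Type*} [NormedAddCommGroup H] [InnerProductSpace ℂ H]

@[simp] lemma rankOne_apply (a b x : H) : rankOne a b x = inner ℂ b x • a := by
  simp [rankOne]

lemma norm_rankOne (a b : H) : ‖rankOne a b‖ = ‖a‖ * ‖b‖ := by
  simp [rankOne, ContinuousLinearMap.norm_smulRight_apply, mul_comm]

lemma rank_rankOne_le (a b : H) : LinearMap.rank (rankOne a b : H →ₗ[ℂ] H) ≤ 1 := by
  refine (Submodule.rank_mono (t := Submodule.span ℂ {a}) ?_).trans (rank_span_le _ |>.trans ?_)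
  · rintro _ ⟨x, rfl⟩
    exact Submodule.mem_span_singleton.2 ⟨inner ℂ b x, by simp⟩
  · simp

lemma rank_sum_le {ι : Type*} (s : Finset ι) (F : ι → H →L[ℂ] H) (r : ℕ)
    (hF : ∀ i ∈ s, LinearMap.rank (F i : H →ₗ[ℂ] H) ≤ r) :
    LinearMap.rank ((∑ i ∈ s, F i : H →L[ℂ] H) : H →ₗ[ℂ] H) ≤ (s.card * r : ℕ) := by
  classical
  induction s using Finset.induction_on with
  | empty => simp
  | insert a s ha ih =>
    rw [Finset.sum_insert ha, Finset.card_insert_of_notMem ha, ContinuousLinearMap.toLinearMap_add,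
      add_mul, one_mul, add_comm, add_comm (s.card * r)]
    refine (LinearMap.rank_add_le _ _).trans ?_
    push_cast
    rw [add_comm]
    refine add_le_add (hF a (by simp)) ?_
    simpa using ih fun i hi => hF i (by simp [hi])

lemma continuous_rankOne_self : Continuous fun u : H => rankOne u u := by
  have : (fun u : H => rankOne u u) =
      fun u => ContinuousLinearMap.smulRightL ℂ H H (innerSL ℂ u) u := by
    ext u x; simp
  rw [this]
  fun_prop

/-- A finite sum `∑ |u i⟩⟨u i|` over an orthogonal family has norm at most `max ‖u i‖²`. -/
lemma norm_sum_rankOne_le {ι : Type*} {u : ι → H}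
    (hu : Pairwise fun i j => inner ℂ (u i) (u j) = 0) {t : ℝ} (ht : 0 ≤ t) (s : Finset ι)
    (hs : ∀ i ∈ s, ‖u i‖ ^ 2 ≤ t) : ‖∑ i ∈ s, rankOne (u i) (u i)‖ ≤ t := by
  classical
  refine ContinuousLinearMap.opNorm_le_bound _ ht fun x => ?_
  set y := (∑ i ∈ s, rankOne (u i) (u i)) x with hy
  have hy' : y = ∑ i ∈ s, inner ℂ (u i) x • u i := by simp [hy]
  have h1 : ‖y‖ ^ 2 = ∑ i ∈ s, ‖inner ℂ (u i) x‖ ^ 2 * ‖u i‖ ^ 2 := by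
    have h : inner ℂ y y = ∑ i ∈ s, ((‖inner ℂ (u i) x‖ ^ 2 * ‖u i‖ ^ 2 : ℝ) : ℂ) := by
      conv_lhs => rw [hy']
      rw [sum_inner]
      refine Finset.sum_congr rfl fun i hi => ?_
      rw [inner_sum, Finset.sum_eq_single i]
      · rw [inner_smul_left, inner_smul_right, inner_self_eq_norm_sq_to_K, ← mul_assoc,
          RCLike.conj_mul]
        push_cast
        rfl
      · intro j _ hj
        rw [inner_smul_left, inner_smul_right, hu hj.symm]
        simp
      · exact fun h => absurd hi h
    rw [inner_self_eq_norm_sq_to_K, ← Complex.ofReal_sum] at h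
    exact Complex.ofReal_injective (by simpa using h)
  have h2 : ∑ i ∈ s, ‖inner ℂ (u i) x‖ ^ 2 ≤ ‖x‖ * ‖y‖ := by
    have h : inner ℂ x y = ((∑ i ∈ s, ‖inner ℂ (u i) x‖ ^ 2 : ℝ) : ℂ) := by
      rw [hy', inner_sum]
      push_cast
      refine Finset.sum_congr rfl fun i _ => ?_
      rw [inner_smul_right, ← inner_conj_symm x (u i), RCLike.mul_conj]
      rfl
    have h' := norm_inner_le_norm (𝕜 := ℂ) x y
    rw [h, Complex.norm_real, Real.norm_of_nonneg (by positivity)] at h'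
    exact h'
  have h3 : ‖y‖ ^ 2 ≤ t * (‖x‖ * ‖y‖) := by
    rw [h1]
    calc _ ≤ ∑ i ∈ s, ‖inner ℂ (u i) x‖ ^ 2 * t :=
          Finset.sum_le_sum fun i hi => mul_le_mul_of_nonneg_left (hs i hi) (by positivity)
      _ = t * ∑ i ∈ s, ‖inner ℂ (u i) x‖ ^ 2 := by rw [← Finset.sum_mul, mul_comm]
      _ ≤ _ := mul_le_mul_of_nonneg_left h2 ht
  rcases (norm_nonneg y).eq_or_lt with h0 | h0
  · rw [← h0]; positivity
  · refine le_of_mul_le_mul_right ?_ h0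
    nlinarith

/-- The approximation numbers of `∑ |u i⟩⟨u i|`, for an orthogonal family `u`, are dominated by
the decreasing rearrangement of `‖u i‖²`. -/
lemma encard_approxNum_le {ι : Type*} {u : ι → H}
    (hu : Pairwise fun i j => inner ℂ (u i) (u j) = 0) {T : H →L[ℂ] H}
    (hT : HasSum (fun i => rankOne (u i) (u i)) T) {t : ℝ} (ht : 0 ≤ t) :
    {n | t < approxNum T n}.encard ≤ {i | t < ‖u i‖ ^ 2}.encard := by
  classical
  by_cases hfin : {i | t < ‖u i‖ ^ 2}.Finite
  · set J := hfin.toFinset with hJ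
    have hrank := rank_sum_le J (fun i => rankOne (u i) (u i)) 1
      (fun i _ => by simpa using rank_rankOne_le (u i) (u i))
    rw [mul_one] at hrank
    have hnorm : ‖T - ∑ i ∈ J, rankOne (u i) (u i)‖ ≤ t := by
      have hlim : Filter.Tendsto
          (fun s : Finset ι => ‖(∑ i ∈ s, rankOne (u i) (u i)) - ∑ i ∈ J, rankOne (u i) (u i)‖)
          Filter.atTop (nhds ‖T - ∑ i ∈ J, rankOne (u i) (u i)‖) :=
        (Filter.Tendsto.sub_const hT _).norm
      refine le_of_tendsto hlim ?_
      filter_upwards [Filter.eventually_ge_atTop J] with s hs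
      rw [← Finset.sum_sdiff hs, add_sub_cancel_right]
      refine norm_sum_rankOne_le hu ht _ fun i hi => ?_
      have := (Finset.mem_sdiff.1 hi).2
      simpa [hJ] using this
    have hsub : {n | t < approxNum T n} ⊆ (Finset.range J.card : Set ℕ) := by
      intro n hn
      by_contra h
      have h' : J.card ≤ n := by simpa using h
      exact absurd (Set.mem_ofPred.1 hn) (not_lt.2 ((approxNum_antitone T h').trans
        ((approxNum_le_norm_sub T _ hrank).trans hnorm)))
    refine (Set.encard_le_encard hsub).trans ?_
    rw [Set.encard_coe_eq_coe_finsetCard, Finset.card_range, hfin.encard_eq_coe_toFinset_card]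
  · rw [Set.encard_eq_top (s := {i | t < ‖u i‖ ^ 2}) hfin]
    exact le_top

lemma tsum_ofReal_eq_lintegral_encard {ι : Type*} [Countable ι] {f : ι → ℝ} :
    ∑' i, ENNReal.ofReal (f i) =
      ∫⁻ t in Set.Ioi (0 : ℝ), ((({i | t < f i}.encard : ℕ∞) : ℝ≥0∞)) := by
  have h (i : ι) : ENNReal.ofReal (f i) =
      ∫⁻ t in Set.Ioi (0 : ℝ), (Set.Iio (f i)).indicator 1 t := by
    rw [lintegral_indicator_one measurableSet_Iio, Measure.restrict_apply measurableSet_Iio,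
      Set.inter_comm, Set.Ioi_inter_Iio, Real.volume_Ioo, sub_zero]
  simp_rw [h]
  rw [← lintegral_tsum fun i => (measurable_one.indicator measurableSet_Iio).aemeasurable]
  refine lintegral_congr fun t => ?_
  rw [← ENNReal.tsum_set_one, tsum_subtype {i | t < f i} (fun _ => (1 : ℝ≥0∞))]
  refine tsum_congr fun i => ?_
  simp [Set.indicator_apply]

lemma schattenNorm_one_le_of_orthogonal {ι : Type*} [Countable ι] {u : ι → H}
    (hu : Pairwise fun i j => inner ℂ (u i) (u j) = 0) {T : H →L[ℂ] H}
    (hT : HasSum (fun i => rankOne (u i) (u i)) T) :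
    schattenNorm 1 T ≤ ∑' i, ENNReal.ofReal (‖u i‖ ^ 2) := by
  rw [schattenNorm_one, tsum_ofReal_eq_lintegral_encard, tsum_ofReal_eq_lintegral_encard]
  refine setLIntegral_mono' measurableSet_Ioi fun t ht => ?_
  exact_mod_cast encard_approxNum_le hu hT (le_of_lt ht)

end RankOne

section Energy

/-- Smooth compactly supported functions `ℝ → ℂ`. -/
def testFun : Submodule ℂ (ℝ → ℂ) where
  carrier := {φ | ContDiff ℝ (⊤ : ℕ∞) φ ∧ HasCompactSupport φ}
  add_mem' ha hb := ⟨ha.1.add hb.1, ha.2.add hb.2⟩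
  zero_mem' := ⟨contDiff_const, HasCompactSupport.zero⟩
  smul_mem' _ _ hf := ⟨contDiff_const.smul hf.1, hf.2.smul_left⟩

namespace testFun

lemma contDiff (φ : testFun) : ContDiff ℝ (⊤ : ℕ∞) (φ : ℝ → ℂ) := φ.2.1

lemma hasCompactSupport (φ : testFun) : HasCompactSupport (φ : ℝ → ℂ) := φ.2.2

lemma memLp (φ : testFun) : MemLp (φ : ℝ → ℂ) 2 volume :=
  (testFun.contDiff φ).continuous.memLp_of_hasCompactSupport (testFun.hasCompactSupport φ)

lemma differentiable (φ : testFun) : Differentiable ℝ (φ : ℝ → ℂ) :=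
  (testFun.contDiff φ).differentiable (by simp)

/-- The derivative of a test function, as a test function. -/
noncomputable def derivative : testFun →ₗ[ℂ] testFun where
  toFun φ := ⟨deriv φ, (contDiff_infty_iff_deriv.1 (testFun.contDiff φ)).2,
    (testFun.hasCompactSupport φ).deriv⟩
  map_add' φ ψ := by
    ext x
    exact deriv_add ((testFun.differentiable φ) x) ((testFun.differentiable ψ) x)
  map_smul' c φ := by
    ext x
    exact deriv_const_smul c ((testFun.differentiable φ) x)

/-- The class in `L²` of a test function. -/
noncomputable def toL2 : testFun →ₗ[ℂ] Lp ℂ 2 (volume : Measure ℝ) where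
  toFun φ := (testFun.memLp φ).toLp φ
  map_add' _ _ := rfl
  map_smul' _ _ := rfl

lemma coeFn_toL2 (φ : testFun) : (toL2 φ : ℝ → ℂ) =ᵐ[volume] φ := (testFun.memLp φ).coeFn_toLp

lemma toL2_injective : Function.Injective toL2 := by
  intro φ ψ h
  have h1 : (φ : ℝ → ℂ) =ᵐ[volume] ψ := by
    filter_upwards [coeFn_toL2 φ, coeFn_toL2 ψ] with x hφ hψ
    rw [← hφ, h, hψ]
  exact Subtype.ext
    (((testFun.contDiff φ).continuous.ae_eq_iff_eq volume (testFun.contDiff ψ).continuous).1 h1)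

/-- A real-valued smooth compactly supported function, as a test function. -/
noncomputable def ofReal (φ : ℝ → ℝ) (h : ContDiff ℝ (⊤ : ℕ∞) φ) (h' : HasCompactSupport φ) :
    testFun :=
  ⟨fun x => Complex.ofReal (φ x), Complex.ofRealCLM.contDiff.comp h,
    h'.comp_left (g := Complex.ofReal) Complex.ofReal_zero⟩

lemma derivative_ofReal {φ : ℝ → ℝ} (h : ContDiff ℝ (⊤ : ℕ∞) φ) (h' : HasCompactSupport φ)
    (x : ℝ) : (derivative (ofReal φ h h') : ℝ → ℂ) x = Complex.ofReal (deriv φ x) :=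
  ((h.differentiable (by simp) x).hasDerivAt.ofReal_comp).deriv

end testFun

lemma enorm_sq_Lp_two (u : Lp ℂ 2 (volume : Measure ℝ)) :
    ENNReal.ofReal (‖u‖ ^ 2) = ∫⁻ x, ENNReal.ofReal (‖u x‖ ^ 2) := by
  have h := L2.inner_def (𝕜 := ℂ) u u
  simp only [inner_self_eq_norm_sq_to_K] at h
  rw [← ofReal_integral_eq_lintegral_ofReal]
  · congr 1
    have h2 : ((‖u‖ ^ 2 : ℝ) : ℂ) = ((∫ x, ‖u x‖ ^ 2 : ℝ) : ℂ) := by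
      rw [← integral_complex_ofReal]
      simpa using h
    exact Complex.ofReal_injective h2
  · exact (Lp.memLp u).integrable_norm_pow (by norm_num)
  · exact Filter.Eventually.of_forall fun x => by positivity

/-- The squared `L²` norm of the weak derivative, by duality with test functions. -/
noncomputable def kinetic (u : Lp ℂ 2 (volume : Measure ℝ)) : ℝ≥0∞ :=
  ⨆ φ : testFun, ENNReal.ofReal
    (‖inner ℂ u (testFun.toL2 (testFun.derivative φ))‖ ^ 2 / ‖testFun.toL2 φ‖ ^ 2)

/-- The squared `L²` norm of `x ↦ x * u x`. -/
noncomputable def potential (u : Lp ℂ 2 (volume : Measure ℝ)) : ℝ≥0∞ :=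
  ∫⁻ x : ℝ, ENNReal.ofReal (x ^ 2 * ‖u x‖ ^ 2)

/-- The energy `‖Xu‖² + ‖∇u‖²`. -/
noncomputable def energy (u : Lp ℂ 2 (volume : Measure ℝ)) : ℝ≥0∞ := potential u + kinetic u

lemma lowerSemicontinuous_kinetic : LowerSemicontinuous kinetic := by
  refine lowerSemicontinuous_iSup fun φ => Continuous.lowerSemicontinuous ?_
  refine ENNReal.continuous_ofReal.comp (Continuous.div_const (Continuous.pow ?_ 2) _)
  fun_prop

lemma lowerSemicontinuous_potential : LowerSemicontinuous potential := by
  rw [lowerSemicontinuous_iff_isClosed_preimage]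
  intro c
  refine IsSeqClosed.isClosed fun u v hu huv => ?_
  obtain ⟨ns, -, hns⟩ := (tendstoInMeasure_of_tendsto_Lp huv).exists_seq_tendsto_ae
  refine le_trans ?_ (Filter.liminf_le_of_frequently_le' (f := Filter.atTop)
    (u := fun n => potential (u (ns n))) (x := c) (Filter.Frequently.of_forall fun n => hu (ns n)))
  calc potential v
      = ∫⁻ x : ℝ, Filter.liminf (fun n => ENNReal.ofReal (x ^ 2 * ‖u (ns n) x‖ ^ 2))
          Filter.atTop := by
        refine lintegral_congr_ae ?_
        filter_upwards [hns] with x hx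
        exact (Filter.Tendsto.liminf_eq ((ENNReal.continuous_ofReal.tendsto _).comp
          ((hx.norm.pow 2).const_mul _))).symm
    _ ≤ _ := lintegral_liminf_le' fun n => by
        have := (Lp.aestronglyMeasurable (u (ns n))).norm.aemeasurable
        fun_prop

lemma lowerSemicontinuous_energy : LowerSemicontinuous energy :=
  lowerSemicontinuous_potential.add lowerSemicontinuous_kinetic

lemma kinetic_smul (c : ℂ) (u : Lp ℂ 2 (volume : Measure ℝ)) :
    kinetic (c • u) = ENNReal.ofReal (‖c‖ ^ 2) * kinetic u := by
  rw [kinetic, kinetic, ENNReal.mul_iSup]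
  refine iSup_congr fun φ => ?_
  rw [← ENNReal.ofReal_mul (by positivity), inner_smul_left, norm_mul, RCLike.norm_conj]
  congr 1
  ring

lemma potential_smul (c : ℂ) (u : Lp ℂ 2 (volume : Measure ℝ)) :
    potential (c • u) = ENNReal.ofReal (‖c‖ ^ 2) * potential u := by
  rw [potential, potential, ← lintegral_const_mul' _ _ ENNReal.ofReal_ne_top]
  refine lintegral_congr_ae ?_
  filter_upwards [Lp.coeFn_smul c u] with x hx
  rw [hx, ← ENNReal.ofReal_mul (by positivity), Pi.smul_apply, norm_smul]
  congr 1
  ring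

lemma energy_smul (c : ℂ) (u : Lp ℂ 2 (volume : Measure ℝ)) :
    energy (c • u) = ENNReal.ofReal (‖c‖ ^ 2) * energy u := by
  rw [energy, energy, potential_smul, kinetic_smul, mul_add]

@[simp] lemma energy_zero : energy 0 = 0 := by
  simpa using energy_smul 0 0

lemma norm_inner_derivative_sq_le {u : Lp ℂ 2 (volume : Measure ℝ)} {R : ℝ} (hR : 0 ≤ R)
    (hu : kinetic u ≤ ENNReal.ofReal R) (φ : testFun) :
    ‖inner ℂ u (testFun.toL2 (testFun.derivative φ))‖ ^ 2 ≤ R * ‖testFun.toL2 φ‖ ^ 2 := by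
  rcases eq_or_ne φ 0 with rfl | hφ
  · simp
  · have h0 : 0 < ‖testFun.toL2 φ‖ := by
      rw [norm_pos_iff]
      exact fun h => hφ (testFun.toL2_injective (by simpa using h))
    have h := (le_iSup (fun φ : testFun => ENNReal.ofReal
      (‖inner ℂ u (testFun.toL2 (testFun.derivative φ))‖ ^ 2 / ‖testFun.toL2 φ‖ ^ 2)) φ).trans hu
    rw [ENNReal.ofReal_le_ofReal_iff hR, div_le_iff₀ (by positivity)] at h
    exact h

end Energy

lemma exists_inner_eq_of_bound {V H : Type*} [AddCommGroup V] [Module ℂ V]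
    [NormedAddCommGroup H] [InnerProductSpace ℂ H] [CompleteSpace H] (i : V →ₗ[ℂ] H)
    (hi : Function.Injective i) (L : V →ₗ[ℂ] ℂ) {K : ℝ} (hK : 0 ≤ K)
    (hL : ∀ v, ‖L v‖ ≤ K * ‖i v‖) : ∃ g : H, ‖g‖ ≤ K ∧ ∀ v, inner ℂ g (i v) = L v := by
  set e := LinearEquiv.ofInjective i hi
  have he (y : LinearMap.range i) : i (e.symm y) = y :=
    congrArg Subtype.val (e.apply_symm_apply y)
  obtain ⟨F, hF, hF'⟩ := exists_extension_norm_eq (LinearMap.range i)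
    ((L ∘ₗ e.symm.toLinearMap).mkContinuous K fun y => by
      simpa [he] using hL (e.symm y))
  refine ⟨(InnerProductSpace.toDual ℂ H).symm F, ?_, fun v => ?_⟩
  · rw [LinearIsometryEquiv.norm_map, hF']
    exact LinearMap.mkContinuous_norm_le _ hK _
  · rw [InnerProductSpace.toDual_symm_apply]
    have h := hF (e v)
    simpa [e] using h

lemma inner_toL2 {u : Lp ℂ 2 (volume : Measure ℝ)} {ψ : ℝ → ℂ} (hψ : (u : ℝ → ℂ) =ᵐ[volume] ψ)
    (φ : testFun) : inner ℂ u (testFun.toL2 φ) = ∫ x, φ.1 x * starRingEnd ℂ (ψ x) := by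
  rw [L2.inner_def]
  refine integral_congr_ae ?_
  filter_upwards [hψ, testFun.coeFn_toL2 φ] with x h1 h2
  rw [h1, h2, RCLike.inner_apply]

/-- A function of finite kinetic energy has a square integrable weak derivative. -/
lemma exists_hasWeakDeriv {u : Lp ℂ 2 (volume : Measure ℝ)} (hu : kinetic u ≠ ∞) :
    ∃ g : Lp ℂ 2 (volume : Measure ℝ), HasWeakDeriv u g ∧
      (∫⁻ x, ENNReal.ofReal (‖g x‖ ^ 2)) ≤ kinetic u := by
  obtain ⟨g, hg, hgL⟩ := exists_inner_eq_of_bound testFun.toL2 testFun.toL2_injective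
    (-((innerSL ℂ u).toLinearMap ∘ₗ testFun.toL2 ∘ₗ testFun.derivative))
    (K := √(kinetic u).toReal) (Real.sqrt_nonneg _) (fun φ => by
      have h := norm_inner_derivative_sq_le (u := u) ENNReal.toReal_nonneg
        (ENNReal.ofReal_toReal hu).ge φ
      rw [← Real.sqrt_sq (norm_nonneg (testFun.toL2 φ)), ← Real.sqrt_mul ENNReal.toReal_nonneg]
      refine Real.le_sqrt_of_sq_le ?_
      simpa using h)
  refine ⟨g, fun φ h h' => ?_, ?_⟩
  · have key := hgL (testFun.ofReal φ h h')
    simp only [LinearMap.neg_apply, LinearMap.comp_apply, ContinuousLinearMap.coe_coe,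
      innerSL_apply_apply] at key
    rw [inner_toL2 Filter.EventuallyEq.rfl, inner_toL2 Filter.EventuallyEq.rfl] at key
    have key' := congrArg (starRingEnd ℂ) key
    rw [map_neg, ← integral_conj, ← integral_conj] at key'
    rw [eq_neg_iff_add_eq_zero, add_comm, ← eq_neg_iff_add_eq_zero]
    have e1 (x : ℝ) : starRingEnd ℂ ((testFun.ofReal φ h h').1 x * starRingEnd ℂ (g x)) =
        g x * Complex.ofReal (φ x) := by
      simp [testFun.ofReal, mul_comm]
    have e2 (x : ℝ) : starRingEnd ℂ ((testFun.derivative (testFun.ofReal φ h h')).1 x *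
        starRingEnd ℂ (u x)) = u x * Complex.ofReal (deriv φ x) := by
      simp [testFun.derivative_ofReal, mul_comm]
    simp only [e1, e2] at key'
    exact key'
  · rw [← enorm_sq_Lp_two, ← ENNReal.ofReal_toReal hu]
    refine ENNReal.ofReal_le_ofReal ?_
    rw [← Real.sq_sqrt (ENNReal.toReal_nonneg (a := kinetic u))]
    gcongr

lemma enorm_integral_mul_sq_le {g η : ℝ → ℂ} (hη : Measurable η)
    (hgη : Integrable fun x => g x * η x) :
    ‖∫ x, g x * η x‖ₑ ^ 2 ≤
      (∫⁻ x, ENNReal.ofReal (‖g x‖ ^ 2)) * ∫⁻ x, ENNReal.ofReal (‖η x‖ ^ 2) := by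
  set g' : ℝ → ℂ := fun x => g x * η x / η x with hg'
  have hmeas : AEMeasurable (fun x => ‖g' x‖ₑ) :=
    (hgη.aestronglyMeasurable.aemeasurable.div hη.aemeasurable).enorm
  have hsq (z : ℂ) : ENNReal.ofReal (‖z‖ ^ 2) = ‖z‖ₑ ^ (2 : ℝ) := by
    rw [ENNReal.ofReal_pow (norm_nonneg _), ofReal_norm]
    norm_cast
  have hroot (a : ℝ≥0∞) : (a ^ (1 / (2 : ℝ))) ^ 2 = a := by
    rw [← ENNReal.rpow_two, ← ENNReal.rpow_mul]
    norm_num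
  have hholder := ENNReal.lintegral_mul_le_Lp_mul_Lq volume Real.HolderConjugate.two_two
    hmeas hη.enorm.aemeasurable
  have h1 : ‖∫ x, g x * η x‖ₑ ≤ ∫⁻ x, ‖g' x‖ₑ * ‖η x‖ₑ := by
    refine (enorm_integral_le_lintegral_enorm _).trans (lintegral_mono fun x => ?_)
    rw [← enorm_mul, hg']
    rcases eq_or_ne (η x) 0 with h | h <;> simp [h]
  calc _ ≤ (∫⁻ x, ‖g' x‖ₑ * ‖η x‖ₑ) ^ 2 := by gcongr
    _ ≤ ((∫⁻ x, ‖g' x‖ₑ ^ (2 : ℝ)) ^ (1 / (2 : ℝ)) *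
          (∫⁻ x, ‖η x‖ₑ ^ (2 : ℝ)) ^ (1 / (2 : ℝ))) ^ 2 := by
        gcongr
        exact hholder
    _ = (∫⁻ x, ‖g' x‖ₑ ^ (2 : ℝ)) * ∫⁻ x, ‖η x‖ₑ ^ (2 : ℝ) := by
        rw [mul_pow, hroot, hroot]
    _ ≤ _ := by
        simp_rw [hsq]
        gcongr with x
        rw [hg']
        rcases eq_or_ne (η x) 0 with h | h <;> simp [h]

/-- The kinetic energy is bounded by the squared norm of any weak derivative. No integrability of
`g` is needed: test functions against which `g` is not integrable contribute nothing. -/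
lemma kinetic_le_of_hasWeakDeriv {u : Lp ℂ 2 (volume : Measure ℝ)} {ψ g : ℝ → ℂ}
    (hψ : (u : ℝ → ℂ) =ᵐ[volume] ψ) (hg : HasWeakDeriv ψ g) :
    kinetic u ≤ ∫⁻ x, ENNReal.ofReal (‖g x‖ ^ 2) := by
  have hreal (f : ℝ → ℝ) (h : ContDiff ℝ (⊤ : ℕ∞) f) (h' : HasCompactSupport f) :
      ∃ η : ℝ → ℝ, Measurable η ∧ (∀ x, |η x| ≤ |f x|) ∧
        (Integrable fun x => g x * (η x : ℂ)) ∧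
        ∫ x, ψ x * Complex.ofReal (deriv f x) = -∫ x, g x * (η x : ℂ) := by
    by_cases hint : Integrable fun x => g x * (f x : ℂ)
    · exact ⟨f, h.continuous.measurable, fun x => le_rfl, hint, hg f h h'⟩
    · exact ⟨0, measurable_const, fun x => by simp, by simp,
        by rw [hg f h h', integral_undef hint]; simp⟩
  refine iSup_le fun φ => ?_
  have hre : ContDiff ℝ (⊤ : ℕ∞) fun x => (φ.1 x).re :=
    Complex.reCLM.contDiff.comp (testFun.contDiff φ)
  have him : ContDiff ℝ (⊤ : ℕ∞) fun x => (φ.1 x).im :=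
    Complex.imCLM.contDiff.comp (testFun.contDiff φ)
  have hre' : HasCompactSupport fun x => (φ.1 x).re :=
    (testFun.hasCompactSupport φ).comp_left (g := Complex.re) rfl
  have him' : HasCompactSupport fun x => (φ.1 x).im :=
    (testFun.hasCompactSupport φ).comp_left (g := Complex.im) rfl
  obtain ⟨a, ham, hale, hai, hag⟩ := hreal _ hre hre'
  obtain ⟨b, hbm, hble, hbi, hbg⟩ := hreal _ him him'
  set η : ℝ → ℂ := fun x => a x - b x * Complex.I with hη
  have hηm : Measurable η := by fun_prop
  have hηle (x : ℝ) : ‖η x‖ ^ 2 ≤ ‖φ.1 x‖ ^ 2 := by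
    rw [← Complex.normSq_eq_norm_sq, ← Complex.normSq_eq_norm_sq, Complex.normSq_apply,
      Complex.normSq_apply, ← sq, ← sq, ← sq, ← sq]
    have h1 := sq_le_sq.2 (hale x)
    have h2 := sq_le_sq.2 (hble x)
    simpa [hη] using add_le_add h1 h2
  have hgη : Integrable fun x => g x * η x := by
    have : (fun x => g x * η x) = fun x => g x * (a x : ℂ) - g x * (b x : ℂ) * Complex.I := by
      funext x; simp only [hη]; ring
    rw [this]
    exact hai.sub (hbi.mul_const _)
  have hψ2 : MemLp ψ 2 volume := (memLp_congr_ae hψ).1 (Lp.memLp u)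
  have hint (f : ℝ → ℝ) (h : ContDiff ℝ (⊤ : ℕ∞) f) (h' : HasCompactSupport f) :
      Integrable fun x => ψ x * Complex.ofReal (deriv f x) := by
    have := (testFun.memLp (testFun.derivative (testFun.ofReal f h h')))
    have := hψ2.integrable_mul this
    refine this.congr (Filter.Eventually.of_forall fun x => ?_)
    simp [testFun.derivative_ofReal]
  have hinner : ‖inner ℂ u (testFun.toL2 (testFun.derivative φ))‖ = ‖∫ x, g x * η x‖ := by
    rw [inner_toL2 hψ, ← RCLike.norm_conj, ← integral_conj, ← norm_neg (∫ x, g x * η x)]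
    congr 1
    calc _ = ∫ x, (ψ x * Complex.ofReal (deriv (fun x => (φ.1 x).re) x) -
              ψ x * Complex.ofReal (deriv (fun x => (φ.1 x).im) x) * Complex.I) := by
          refine integral_congr_ae (Filter.Eventually.of_forall fun x => ?_)
          have hd := (testFun.differentiable φ x).hasDerivAt
          have h1 : deriv (fun x => (φ.1 x).re) x = (deriv φ.1 x).re :=
            (Complex.reCLM.hasFDerivAt.comp_hasDerivAt x hd).deriv
          have h2 : deriv (fun x => (φ.1 x).im) x = (deriv φ.1 x).im :=
            (Complex.imCLM.hasFDerivAt.comp_hasDerivAt x hd).deriv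
          simp only [h1, h2, testFun.derivative, LinearMap.coe_mk, AddHom.coe_mk, map_mul,
            Complex.conj_conj]
          have hc : starRingEnd ℂ (deriv φ.1 x) =
              (deriv φ.1 x).re - (deriv φ.1 x).im * Complex.I := by
            apply Complex.ext <;> simp
          rw [hc]
          ring
      _ = -∫ x, g x * η x := by
          rw [integral_sub (hint _ hre hre') ((hint _ him him').mul_const _),
            integral_mul_const, hag, hbg]
          have : (fun x => g x * η x) =
              fun x => g x * (a x : ℂ) - g x * (b x : ℂ) * Complex.I := by
            funext x; simp only [hη]; ring
          rw [this, integral_sub hai (hbi.mul_const _), integral_mul_const]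
          ring
  rcases eq_or_ne φ 0 with rfl | hφ
  · simp
  have h0 : 0 < ‖testFun.toL2 φ‖ := by
    rw [norm_pos_iff]
    exact fun h => hφ (testFun.toL2_injective (by simpa using h))
  rw [ENNReal.ofReal_div_of_pos (by positivity)]
  refine ENNReal.div_le_of_le_mul ?_
  rw [hinner, ENNReal.ofReal_pow (norm_nonneg _), ofReal_norm, enorm_sq_Lp_two]
  refine (enorm_integral_mul_sq_le hηm hgη).trans ?_
  refine mul_le_mul_right ?_ _
  refine lintegral_mono_ae ?_
  filter_upwards [testFun.coeFn_toL2 φ] with x hx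
  rw [hx]
  exact ENNReal.ofReal_le_ofReal (hηle x)

/-- The difference of two translates of a mollifier, integrated. -/
lemma mollifier_sub_sq_le {u : Lp ℂ 2 (volume : Measure ℝ)} {R : ℝ} (hR : 0 ≤ R)
    (hu : kinetic u ≤ ENNReal.ofReal R) (f : ContDiffBump (0 : ℝ)) {x y : ℝ} (hyx : y ≤ x) :
    ‖convolution (f.normed volume) u (ContinuousLinearMap.lsmul ℝ ℝ) volume x -
      convolution (f.normed volume) u (ContinuousLinearMap.lsmul ℝ ℝ) volume y‖ ^ 2 ≤
      R * (x - y + 2 * f.rOut) := by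
  set w := f.normed volume with hw
  have hwc : Continuous w := f.continuous_normed
  have hw0 (t : ℝ) : 0 ≤ w t := f.nonneg_normed t
  have hwout (t : ℝ) (ht : f.rOut ≤ |t|) : w t = 0 := by
    by_contra h
    have : t ∈ Function.support w := h
    rw [hw, f.support_normed_eq, Metric.mem_ball, Real.dist_eq, sub_zero] at this
    linarith
  set F : ℝ → ℝ := fun s => ∫ t in (0 : ℝ)..s, w t with hF
  have hFd (s : ℝ) : HasDerivAt F (w s) s := (hwc.integral_hasStrictDerivAt 0 s).hasDerivAt
  have hFc : ContDiff ℝ (⊤ : ℕ∞) F := by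
    refine contDiff_infty_iff_deriv.2 ⟨fun s => (hFd s).differentiableAt, ?_⟩
    rw [show deriv F = w from funext fun s => (hFd s).deriv]
    exact f.contDiff_normed
  set Φ : ℝ → ℝ := fun s => F (s - y) - F (s - x) with hΦ
  have hΦc : ContDiff ℝ (⊤ : ℕ∞) Φ :=
    (hFc.comp (contDiff_id.sub contDiff_const)).sub (hFc.comp (contDiff_id.sub contDiff_const))
  have hΦd (s : ℝ) : deriv Φ s = w (s - y) - w (s - x) :=
    (((hFd (s - y)).comp_sub_const s y).sub ((hFd (s - x)).comp_sub_const s x)).deriv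
  have hΦi (s : ℝ) : Φ s = ∫ t in (s - x)..(s - y), w t :=
    intervalIntegral.integral_interval_sub_left (hwc.intervalIntegrable _ _)
      (hwc.intervalIntegrable _ _)
  have hΦ0 (s : ℝ) : 0 ≤ Φ s := by
    rw [hΦi]
    exact intervalIntegral.integral_nonneg (by linarith) fun t _ => hw0 t
  have hΦ1 (s : ℝ) : Φ s ≤ 1 := by
    rw [hΦi, intervalIntegral.integral_of_le (by linarith), ← f.integral_normed (μ := volume)]
    exact setIntegral_le_integral f.integrable_normed (Filter.Eventually.of_forall hw0)
  have hΦs (s : ℝ) (hs : s ∉ Set.Icc (y - f.rOut) (x + f.rOut)) : Φ s = 0 := by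
    rw [hΦi]
    refine intervalIntegral.integral_zero_ae (Filter.Eventually.of_forall fun t ht => ?_)
    rw [Set.uIoc_of_le (by linarith)] at ht
    refine hwout t ?_
    rw [Set.mem_Icc, not_and_or, not_le, not_le] at hs
    rcases hs with hs | hs
    · exact le_trans (by linarith [ht.2]) (neg_le_abs t)
    · exact le_trans (by linarith [ht.1]) (le_abs_self t)
  have hΦk : HasCompactSupport Φ := HasCompactSupport.intro isCompact_Icc hΦs
  have hloc : LocallyIntegrable u volume := (Lp.memLp u).locallyIntegrable (by norm_num)
  have hint (z : ℝ) : Integrable fun s => w (s - z) • u s :=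
    hloc.integrable_smul_left_of_hasCompactSupport (by fun_prop)
      (f.hasCompactSupport_normed.comp_homeomorph (Homeomorph.subRight z))
  have hconv (z : ℝ) : convolution w u (ContinuousLinearMap.lsmul ℝ ℝ) volume z =
      ∫ s, w (s - z) • u s := by
    rw [convolution_lsmul_swap]
    congr 1
    funext s
    rw [← neg_sub s z, hw, f.normed_neg]
  have hinner : ‖inner ℂ u (testFun.toL2 (testFun.derivative (testFun.ofReal Φ hΦc hΦk)))‖ =
      ‖convolution w u (ContinuousLinearMap.lsmul ℝ ℝ) volume x -
        convolution w u (ContinuousLinearMap.lsmul ℝ ℝ) volume y‖ := by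
    rw [inner_toL2 Filter.EventuallyEq.rfl, ← RCLike.norm_conj, ← integral_conj, norm_sub_rev,
      hconv, hconv, ← integral_sub (hint y) (hint x)]
    congr 2
    funext s
    rw [testFun.derivative_ofReal, hΦd]
    simp [sub_mul]
  have hnorm : ‖testFun.toL2 (testFun.ofReal Φ hΦc hΦk)‖ ^ 2 ≤ x - y + 2 * f.rOut := by
    have hr := f.rOut_pos
    rw [← ENNReal.ofReal_le_ofReal_iff (by linarith), enorm_sq_Lp_two]
    calc _ ≤ ∫⁻ s, (Set.Icc (y - f.rOut) (x + f.rOut)).indicator 1 s := by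
          refine lintegral_mono_ae ?_
          filter_upwards [testFun.coeFn_toL2 (testFun.ofReal Φ hΦc hΦk)] with s hs
          rw [hs]
          simp only [testFun.ofReal, Complex.norm_real, Real.norm_eq_abs, sq_abs]
          by_cases h : s ∈ Set.Icc (y - f.rOut) (x + f.rOut)
          · rw [Set.indicator_of_mem h, Pi.one_apply, ENNReal.ofReal_le_one]
            exact pow_le_one₀ (hΦ0 s) (hΦ1 s)
          · simp [hΦs s h]
      _ = _ := by
          rw [lintegral_indicator_one measurableSet_Icc, Real.volume_Icc]
          congr 1
          ring
  rw [← hinner]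
  exact (norm_inner_derivative_sq_le hR hu _).trans (mul_le_mul_of_nonneg_left hnorm hR)

/-- A function with finite kinetic energy is almost everywhere `1/2`-Hölder. -/
lemma exists_ae_holder {u : Lp ℂ 2 (volume : Measure ℝ)} {R : ℝ} (hR : 0 ≤ R)
    (hu : kinetic u ≤ ENNReal.ofReal R) :
    ∃ S : Set ℝ, (∀ᵐ x, x ∈ S) ∧ ∀ x ∈ S, ∀ y ∈ S, ‖u x - u y‖ ^ 2 ≤ R * |x - y| := by
  let f (n : ℕ) : ContDiffBump (0 : ℝ) :=
    ⟨1 / ((n : ℝ) + 1), 2 * (1 / ((n : ℝ) + 1)), by positivity,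
      lt_mul_of_one_lt_left (by positivity) one_lt_two⟩
  have hf : Filter.Tendsto (fun n => (f n).rOut) Filter.atTop (nhds 0) := by
    simpa [f] using tendsto_one_div_add_atTop_nhds_zero_nat.const_mul (2 : ℝ)
  have hae := ContDiffBump.ae_convolution_tendsto_right_of_locallyIntegrable (K := 2)
    (μ := volume) (g := u) hf (Filter.Eventually.of_forall fun n => le_rfl)
    ((Lp.memLp u).locallyIntegrable (by norm_num))
  refine ⟨_, hae, ?_⟩
  have key (x y : ℝ) (hx : Filter.Tendsto (fun i => convolution ((f i).normed volume) u
      (ContinuousLinearMap.lsmul ℝ ℝ) volume x) Filter.atTop (nhds (u x)))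
      (hy : Filter.Tendsto (fun i => convolution ((f i).normed volume) u
      (ContinuousLinearMap.lsmul ℝ ℝ) volume y) Filter.atTop (nhds (u y))) (hyx : y ≤ x) :
      ‖u x - u y‖ ^ 2 ≤ R * (x - y) := by
    refine le_of_tendsto_of_tendsto' ((hx.sub hy).norm.pow 2) (b := Filter.atTop)
      (g := fun n => R * (x - y + 2 * (f n).rOut)) ?_ fun n =>
        mollifier_sub_sq_le hR hu (f n) hyx
    simpa using ((hf.const_mul 2).const_add (x - y)).const_mul R
  intro x hx y hy
  rcases le_total y x with h | h
  · rw [abs_of_nonneg (by linarith)]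
    exact key x y hx hy h
  · rw [norm_sub_rev, abs_sub_comm, abs_of_nonneg (by linarith)]
    exact key y x hy hx h

lemma totallyBounded_of_finiteDimensional_approx {H : Type*} [NormedAddCommGroup H]
    [NormedSpace ℂ H] {B : Set H} (hB : ∀ u ∈ B, ‖u‖ ≤ 1)
    (happ : ∀ ε > 0, ∃ F : Submodule ℂ H, FiniteDimensional ℂ F ∧
      ∀ u ∈ B, ∃ v ∈ F, ‖u - v‖ ≤ ε) : TotallyBounded B := by
  refine Metric.totallyBounded_iff.2 fun ε hε => ?_
  obtain ⟨F, hF, hFB⟩ := happ (ε / 3) (by positivity)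
  have := FiniteDimensional.proper ℂ F
  have hK : IsCompact ((F.subtypeL : F → H) '' Metric.closedBall 0 (1 + ε / 3)) :=
    (isCompact_closedBall _ _).image F.subtypeL.continuous
  obtain ⟨t, ht, htK⟩ := Metric.totallyBounded_iff.1 hK.totallyBounded (ε / 3) (by positivity)
  refine ⟨t, ht, fun u hu => ?_⟩
  obtain ⟨v, hv, huv⟩ := hFB u hu
  have hvn : ‖v‖ ≤ 1 + ε / 3 := by
    have := norm_sub_norm_le v u
    rw [norm_sub_rev] at this
    linarith [hB u hu]
  have hvK : v ∈ ((F.subtypeL : F → H) '' Metric.closedBall 0 (1 + ε / 3)) :=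
    ⟨⟨v, hv⟩, by simpa using hvn, rfl⟩
  obtain ⟨y, hy, hvy⟩ := Set.mem_iUnion₂.1 (htK hvK)
  refine Set.mem_iUnion₂.2 ⟨y, hy, ?_⟩
  rw [Metric.mem_ball] at hvy ⊢
  have := dist_triangle u v y
  rw [dist_eq_norm u v] at this
  linarith

/-- The `k`-th cell of the subdivision of `[-N, N)` into intervals of length `1 / m`. -/
def gridCell (N m : ℝ) (k : ℕ) : Set ℝ := {x | -N ≤ x ∧ x < N ∧ ⌊(x + N) * m⌋₊ = k}

lemma measurableSet_gridCell (N m : ℝ) (k : ℕ) : MeasurableSet (gridCell N m k) := by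
  refine (measurableSet_le measurable_const measurable_id).inter
    ((measurableSet_lt measurable_id measurable_const).inter ?_)
  exact (Nat.measurable_floor.comp (by fun_prop : Measurable fun x : ℝ => (x + N) * m))
    (measurableSet_singleton k)

lemma volume_gridCell_ne_top (N m : ℝ) (k : ℕ) : volume (gridCell N m k) ≠ ∞ :=
  ((measure_mono fun _ hx => ⟨hx.1, hx.2.1.le⟩ : _ ≤ volume (Set.Icc (-N) N)).trans_lt
    measure_Icc_lt_top).ne

lemma abs_sub_le_of_mem_gridCell {N m : ℝ} (hm : 0 < m) {k : ℕ} {x y : ℝ}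
    (hx : x ∈ gridCell N m k) (hy : y ∈ gridCell N m k) : |x - y| ≤ 1 / m := by
  have h (z : ℝ) (hz : z ∈ gridCell N m k) : k ≤ (z + N) * m ∧ (z + N) * m < k + 1 := by
    have h0 : 0 ≤ (z + N) * m := mul_nonneg (by linarith [hz.1]) hm.le
    rw [← hz.2.2]
    exact ⟨Nat.floor_le h0, Nat.lt_floor_add_one _⟩
  have hx' := h x hx
  have hy' := h y hy
  rw [le_div_iff₀ hm, ← abs_of_pos hm, ← abs_mul, abs_le]
  constructor <;> nlinarith

lemma memLp_gridStep (N m : ℝ) (n : ℕ) (c : Fin n → ℂ) :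
    MemLp (fun x => ∑ k : Fin n, (gridCell N m k).indicator (fun _ => c k) x) 2 volume :=
  memLp_finsetSum _ fun k _ => memLp_indicator_const 2 (measurableSet_gridCell N m k) (c k)
    (Or.inr (volume_gridCell_ne_top N m k))

/-- The step function with prescribed values on the first `n` cells. -/
noncomputable def gridStep (N m : ℝ) (n : ℕ) :
    (Fin n → ℂ) →ₗ[ℂ] Lp ℂ 2 (volume : Measure ℝ) where
  toFun c := (memLp_gridStep N m n c).toLp _
  map_add' c d := by
    rw [← MemLp.toLp_add]
    refine MemLp.toLp_congr _ _ (Filter.Eventually.of_forall fun x => ?_)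
    simp only [Pi.add_apply, ← Finset.sum_add_distrib]
    refine Finset.sum_congr rfl fun k _ => ?_
    by_cases h : x ∈ gridCell N m k <;> simp [h]
  map_smul' a c := by
    rw [RingHom.id_apply, ← MemLp.toLp_const_smul]
    refine MemLp.toLp_congr _ _ (Filter.Eventually.of_forall fun x => ?_)
    simp only [Pi.smul_apply, smul_eq_mul, Finset.mul_sum]
    refine Finset.sum_congr rfl fun k _ => ?_
    by_cases h : x ∈ gridCell N m k <;> simp [h]

/-- Functions of bounded energy are uniformly approximated by step functions. -/
lemma exists_gridStep_approx {R N m : ℝ} (hR : 0 ≤ R) (hN : 0 < N) (hm : 0 < m) {n : ℕ}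
    (hn : 2 * N * m < n) {u : Lp ℂ 2 (volume : Measure ℝ)} (hu : energy u ≤ ENNReal.ofReal R) :
    ∃ c, ‖u - gridStep N m n c‖ ^ 2 ≤ R * (1 / m) * (2 * N) + 1 / N ^ 2 * R := by
  classical
  obtain ⟨S, hS, hSu⟩ := exists_ae_holder hR (le_add_self.trans hu)
  set p : ℕ → ℝ := fun k => if h : (gridCell N m k ∩ S).Nonempty then h.some else 0 with hp
  refine ⟨fun k => u (p k), ?_⟩
  set v := gridStep N m n fun k => u (p k) with hv
  have hvx : (v : ℝ → ℂ) =ᵐ[volume]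
      fun x => ∑ k : Fin n, (gridCell N m k).indicator (fun _ => u (p k)) x :=
    (memLp_gridStep N m n _).coeFn_toLp
  rw [← ENNReal.ofReal_le_ofReal_iff (by positivity), enorm_sq_Lp_two]
  calc _ ≤ ∫⁻ x, ((Set.Ico (-N) N).indicator (fun _ => ENNReal.ofReal (R * (1 / m))) x +
        ENNReal.ofReal (1 / N ^ 2) * ENNReal.ofReal (x ^ 2 * ‖u x‖ ^ 2)) := by
        refine lintegral_mono_ae ?_
        filter_upwards [hvx, hS, Lp.coeFn_sub u v] with x hx hxS hsub
        rw [hsub, Pi.sub_apply, hx]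
        by_cases hxN : x ∈ Set.Ico (-N) N
        · rw [Set.indicator_of_mem hxN]
          refine le_add_right (ENNReal.ofReal_le_ofReal ?_)
          have h0 : 0 ≤ (x + N) * m := mul_nonneg (by linarith [hxN.1]) hm.le
          have hkn : ⌊(x + N) * m⌋₊ < n := by
            rw [Nat.floor_lt h0]
            nlinarith [hxN.2]
          have hxk : x ∈ gridCell N m ⌊(x + N) * m⌋₊ := ⟨hxN.1, hxN.2, rfl⟩
          rw [Finset.sum_eq_single ⟨_, hkn⟩, Set.indicator_of_mem hxk]
          · have hne : (gridCell N m ⌊(x + N) * m⌋₊ ∩ S).Nonempty := ⟨x, hxk, hxS⟩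
            have hpk : p ⌊(x + N) * m⌋₊ ∈ gridCell N m ⌊(x + N) * m⌋₊ ∩ S := by
              simp only [hp, dif_pos hne]
              exact hne.some_mem
            exact (hSu x hxS _ hpk.2).trans
              (mul_le_mul_of_nonneg_left (abs_sub_le_of_mem_gridCell hm hxk hpk.1) hR)
          · intro j _ hj
            refine Set.indicator_of_notMem (fun h => hj ?_) _
            exact Fin.ext h.2.2.symm
          · simp
        · rw [Set.indicator_of_notMem hxN, zero_add, ← ENNReal.ofReal_mul (by positivity)]
          refine ENNReal.ofReal_le_ofReal ?_
          rw [Finset.sum_eq_zero fun k _ =>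
            Set.indicator_of_notMem (fun h => hxN ⟨h.1, h.2.1⟩) _, sub_zero]
          have hx2 : N ^ 2 ≤ x ^ 2 := by
            rw [Set.mem_Ico, not_and_or, not_le, not_lt] at hxN
            rcases hxN with h | h <;> nlinarith
          rw [← mul_assoc]
          refine le_mul_of_one_le_left (by positivity) ?_
          rw [one_div, inv_mul_eq_div, one_le_div (by positivity)]
          exact hx2
    _ = ENNReal.ofReal (R * (1 / m)) * ENNReal.ofReal (2 * N) +
          ENNReal.ofReal (1 / N ^ 2) * potential u := by
        rw [lintegral_add_left (measurable_const.indicator measurableSet_Ico),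
          lintegral_indicator_const measurableSet_Ico, Real.volume_Ico,
          lintegral_const_mul' _ _ ENNReal.ofReal_ne_top, potential]
        congr 3
        ring
    _ ≤ ENNReal.ofReal (R * (1 / m)) * ENNReal.ofReal (2 * N) +
          ENNReal.ofReal (1 / N ^ 2) * ENNReal.ofReal R := by
        gcongr
        exact le_self_add.trans hu
    _ = _ := by
        rw [← ENNReal.ofReal_mul (by positivity), ← ENNReal.ofReal_mul (by positivity),
          ← ENNReal.ofReal_add (by positivity) (by positivity)]

/-- Rellich: sublevel sets of the energy in the unit ball of `L²` are compact. -/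
lemma isCompact_energy_le (R : ℝ) (hR : 0 ≤ R) :
    IsCompact {u : Lp ℂ 2 (volume : Measure ℝ) | ‖u‖ ≤ 1 ∧ energy u ≤ ENNReal.ofReal R} := by
  refine TotallyBounded.isCompact_of_isClosed ?_ ?_
  · refine totallyBounded_of_finiteDimensional_approx (fun u hu => hu.1) fun ε hε => ?_
    obtain ⟨N, hN⟩ := exists_nat_gt (2 * R / ε ^ 2 + 1)
    have hN1 : (1 : ℝ) < N := lt_of_le_of_lt (by simpa using by positivity) hN
    obtain ⟨m, hm⟩ := exists_nat_gt (4 * N * R / ε ^ 2 + 1)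
    have hm1 : (1 : ℝ) < m := lt_of_le_of_lt (by simpa using by positivity) hm
    obtain ⟨n, hn⟩ := exists_nat_gt (2 * (N : ℝ) * m)
    refine ⟨LinearMap.range (gridStep N m n), inferInstance, fun u hu => ?_⟩
    obtain ⟨c, hc⟩ := exists_gridStep_approx hR (by linarith) (by linarith) hn hu.2
    refine ⟨_, ⟨c, rfl⟩, ?_⟩
    refine le_of_sq_le_sq (hc.trans ?_) hε.le
    have h1 : R * (1 / m) * (2 * N) ≤ ε ^ 2 / 2 := by
      have : 4 * N * R / ε ^ 2 < m := by linarith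
      rw [div_lt_iff₀ (by positivity)] at this
      rw [show R * (1 / (m : ℝ)) * (2 * N) = 2 * N * R / m by ring, div_le_iff₀ (by linarith)]
      linarith
    have h2 : 1 / (N : ℝ) ^ 2 * R ≤ ε ^ 2 / 2 := by
      have : 2 * R / ε ^ 2 < N := by linarith
      rw [div_lt_iff₀ (by positivity)] at this
      rw [one_div_mul_eq_div, div_le_iff₀ (by positivity)]
      nlinarith [sq_nonneg ε]
    linarith
  · exact (isClosed_le continuous_norm continuous_const).inter
      (lowerSemicontinuous_iff_isClosed_preimage.1 lowerSemicontinuous_energy _)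

/-- The number of orthonormal vectors of bounded energy is bounded. -/
lemma exists_card_le_of_energy_le (R : ℝ) (hR : 0 ≤ R) :
    ∃ C : ℕ, ∀ e : ℕ → Lp ℂ 2 (volume : Measure ℝ), Orthonormal ℂ e → ∀ s : Finset ℕ,
      (∀ j ∈ s, energy (e j) ≤ ENNReal.ofReal R) → s.card ≤ C := by
  obtain ⟨t, ht, htc⟩ := Metric.totallyBounded_iff.1 (isCompact_energy_le R hR).totallyBounded
    (1 / 2) (by norm_num)
  refine ⟨ht.toFinset.card, fun e he s hs => ?_⟩
  have hex (j : ℕ) (hj : j ∈ s) : ∃ y ∈ t, dist (e j) y < 1 / 2 := by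
    simpa using htc ⟨(he.1 j).le, hs j hj⟩
  choose! y hy hey using hex
  refine Finset.card_le_card_of_injOn y (fun j hj => by simpa using hy j hj) ?_
  intro i hi j hj hij
  by_contra hne
  have h1 : dist (e i) (e j) < 1 := by
    have := dist_triangle_right (e i) (e j) (y i)
    have h2 := hey i hi
    have h3 := hey j hj
    rw [← hij] at h3
    linarith
  have h2 : ‖e i - e j‖ ^ 2 = 2 := by
    rw [@norm_sub_sq ℂ, he.2 hne, he.1, he.1]
    norm_num
  rw [dist_eq_norm] at h1
  nlinarith [norm_nonneg (e i - e j)]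

/-- The data of a spectral decomposition `ρ = ∑ |vᵢ⟩⟨vᵢ|` witnessing `ρ ∈ KM M`. -/
structure IsEnergyDecomp {ι : Type*} (M : ℝ) (v : ι → Lp ℂ 2 (volume : Measure ℝ))
    (ρ : Lp ℂ 2 (volume : Measure ℝ) →L[ℂ] Lp ℂ 2 (volume : Measure ℝ)) : Prop where
  orthogonal : Pairwise fun i j => inner ℂ (v i) (v j) = 0
  hasSum_norm_sq : HasSum (fun i => ‖v i‖ ^ 2) 1
  tsum_energy_le : ∑' i, energy (v i) ≤ ENNReal.ofReal M
  hasSum_rankOne : HasSum (fun i => rankOne (v i) (v i)) ρ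

lemma rankOne_ofReal_smul {H : Type*} [NormedAddCommGroup H] [InnerProductSpace ℂ H] (c : ℝ)
    (u : H) : rankOne ((c : ℂ) • u) ((c : ℂ) • u) = (c ^ 2) • rankOne u u := by
  ext x
  rw [smul_apply, rankOne_apply, rankOne_apply, inner_smul_left,
    Complex.conj_ofReal, smul_smul, ← Complex.coe_smul, smul_smul]
  congr 1
  push_cast
  rw [mul_right_comm, ← sq]

lemma rankOne_sqrt_smul {H : Type*} [NormedAddCommGroup H] [InnerProductSpace ℂ H] {c : ℝ}
    (hc : 0 ≤ c) (u : H) :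
    rankOne ((√c : ℂ) • u) ((√c : ℂ) • u) = c • rankOne u u := by
  rw [rankOne_ofReal_smul, Real.sq_sqrt hc]

lemma energy_sqrt_smul {c : ℝ} (hc : 0 ≤ c) (u : Lp ℂ 2 (volume : Measure ℝ)) :
    energy ((√c : ℂ) • u) = ENNReal.ofReal c * energy u := by
  rw [energy_smul, Complex.norm_real, Real.norm_eq_abs, sq_abs, Real.sq_sqrt hc]

lemma norm_sqrt_smul_sq {H : Type*} [NormedAddCommGroup H] [InnerProductSpace ℂ H] {c : ℝ}
    (hc : 0 ≤ c) {u : H} (hu : ‖u‖ = 1) : ‖(√c : ℂ) • u‖ ^ 2 = c := by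
  rw [norm_smul, hu, mul_one, Complex.norm_real, Real.norm_eq_abs, sq_abs, Real.sq_sqrt hc]

lemma exists_isEnergyDecomp_of_mem_KM {M : ℝ}
    {ρ : Lp ℂ 2 (volume : Measure ℝ) →L[ℂ] Lp ℂ 2 (volume : Measure ℝ)} (hρ : ρ ∈ KM M) :
    ∃ (lam : ℕ → ℝ) (e : ℕ → Lp ℂ 2 (volume : Measure ℝ)), (∀ j, 0 ≤ lam j) ∧
      Orthonormal ℂ e ∧ IsEnergyDecomp M (fun j => (√(lam j) : ℂ) • e j) ρ := by
  obtain ⟨lam, e, h0, he, hsum, rfl, ψ, g, hψ, hg, hE⟩ := hρ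
  refine ⟨lam, e, h0, he, fun i j hij => ?_, ?_, le_trans ?_ hE, ?_⟩
  · simp only [inner_smul_left, inner_smul_right, he.2 hij, mul_zero]
  · simpa only [norm_sqrt_smul_sq (h0 _) (he.1 _)] using hsum
  · refine ENNReal.tsum_le_tsum fun j => ?_
    rw [energy_sqrt_smul (h0 j), energy]
    gcongr
    · refine (lintegral_congr_ae ?_).le
      filter_upwards [hψ j] with x hx
      rw [hx]
    · exact kinetic_le_of_hasWeakDeriv (hψ j) (hg j)
  · refine (Summable.of_norm (hsum.summable.congr fun j => ?_)).hasSum_iff.2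
      (tsum_congr fun j => rankOne_sqrt_smul (h0 j) (e j))
    rw [norm_rankOne, ← sq, norm_sqrt_smul_sq (h0 j) (he.1 j)]

lemma HasSum.comp_extend {ι κ H α : Type*} [Zero H] [AddCommMonoid α] [TopologicalSpace α]
    {u : ι → H} {f : {j // u j ≠ 0} → κ} (hf : Function.Injective f) {φ : H → α} (hφ : φ 0 = 0)
    {a : α} (h : HasSum (fun j => φ (u j)) a) :
    HasSum (fun p => φ (Function.extend f (fun j => u j) 0 p)) a := by
  rw [← hf.hasSum_iff]
  · have h' : HasSum (fun j : {j // u j ≠ 0} => φ (u j)) a :=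
      (hasSum_subtype_iff_of_support_subset (s := {j | u j ≠ 0})
        fun j hj hu => hj (by simp only [hu, hφ])).2 h
    simpa only [Function.comp_def, hf.extend_apply] using h'
  · intro p hp
    rw [Function.extend_apply' _ _ _ (fun h => hp h), Pi.zero_apply, hφ]

lemma IsEnergyDecomp.extend {ι κ : Type*} {M : ℝ} {v : ι → Lp ℂ 2 (volume : Measure ℝ)}
    {ρ : Lp ℂ 2 (volume : Measure ℝ) →L[ℂ] Lp ℂ 2 (volume : Measure ℝ)}
    (h : IsEnergyDecomp M v ρ) {f : {j // v j ≠ 0} → κ} (hf : Function.Injective f) :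
    IsEnergyDecomp M (Function.extend f (fun j => v j) 0) ρ where
  orthogonal p q hpq := by
    by_cases hp : ∃ i, f i = p
    · by_cases hq : ∃ j, f j = q
      · obtain ⟨i, rfl⟩ := hp
        obtain ⟨j, rfl⟩ := hq
        simp only [hf.extend_apply]
        exact h.orthogonal fun hij => hpq (congrArg f (Subtype.ext hij))
      · simp only [Function.extend_apply' _ _ _ hq, Pi.zero_apply, inner_zero_right]
    · simp only [Function.extend_apply' _ _ _ hp, Pi.zero_apply, inner_zero_left]
  hasSum_norm_sq := HasSum.comp_extend (φ := fun u => ‖u‖ ^ 2) hf (by simp) h.hasSum_norm_sq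
  tsum_energy_le := by
    rw [(HasSum.comp_extend (φ := energy) hf energy_zero ENNReal.summable.hasSum).tsum_eq]
    exact h.tsum_energy_le
  hasSum_rankOne := HasSum.comp_extend (φ := fun u => rankOne u u) hf (by ext; simp)
    h.hasSum_rankOne

/-- The first coordinates of the injection record the blocks `k`, the second ones enumerate
each block. -/
lemma exists_injective_blocks (S : ℕ → Prop) (k C : ℕ → ℕ)
    (hC : ∀ m (s : Finset ℕ), (∀ j ∈ s, S j ∧ k j = m) → s.card ≤ C m) :
    ∃ f : {j // S j} → ℕ × ℕ, Function.Injective f ∧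
      ∀ j, (f j).1 = k j ∧ (f j).2 < C (k j) := by
  classical
  refine ⟨fun j => (k j, Nat.count (fun i => S i ∧ k i = k j) j), ?_, fun j => ⟨rfl, ?_⟩⟩
  · rintro ⟨i, hi⟩ ⟨j, hj⟩ hij
    obtain ⟨h1, h2⟩ := Prod.mk.inj hij
    simp only [h1] at h2
    rcases lt_trichotomy i j with h | h | h
    · exact absurd h2 (Nat.count_strict_mono ⟨hi, h1⟩ h).ne
    · exact Subtype.ext h
    · exact absurd h2 (Nat.count_strict_mono ⟨hj, rfl⟩ h).ne'
  · have h := hC (k j) {i ∈ Finset.range (j + 1) | S i ∧ k i = k j} (by simp)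
    rw [← Nat.count_eq_card_filter_range, Nat.count_succ, if_pos ⟨j.2, rfl⟩] at h
    exact h

/-- The first `K` blocks, when the `k`-th block has size `C k`. -/
def blocks (C : ℕ → ℕ) (K : ℕ) : Finset (ℕ × ℕ) :=
  (Finset.range K).biUnion fun k => (Finset.range (C k)).map ⟨Prod.mk k, Prod.mk_right_injective k⟩

lemma mem_blocks {C : ℕ → ℕ} {K : ℕ} {p : ℕ × ℕ} : p ∈ blocks C K ↔ p.1 < K ∧ p.2 < C p.1 := by
  obtain ⟨a, b⟩ := p
  simp only [blocks, Finset.mem_biUnion, Finset.mem_range, Finset.mem_map,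
    Function.Embedding.coeFn_mk, Prod.mk.injEq]
  exact ⟨fun ⟨k, hk, i, hi, h1, h2⟩ => by subst h1 h2; exact ⟨hk, hi⟩,
    fun h => ⟨a, h.1, b, h.2, rfl, rfl⟩⟩

/-- Elements of `KM M` have decompositions indexed by `ℕ × ℕ` with uniformly small tails. -/
lemma exists_uniform_isEnergyDecomp (M : ℝ) :
    ∃ C : ℕ → ℕ, ∀ ρ ∈ KM M, ∃ v : ℕ × ℕ → Lp ℂ 2 (volume : Measure ℝ),
      IsEnergyDecomp M v ρ ∧ ∀ (K : ℕ) (p : ℕ × ℕ), p ∉ blocks C K →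
        K * ENNReal.ofReal (‖v p‖ ^ 2) ≤ energy (v p) := by
  choose C hC using fun k : ℕ => exists_card_le_of_energy_le (k + 1) (by positivity)
  refine ⟨C, fun ρ hρ => ?_⟩
  obtain ⟨lam, e, h0, he, h⟩ := exists_isEnergyDecomp_of_mem_KM hρ
  set u := fun j => (√(lam j) : ℂ) • e j with hu
  have henergy (j : ℕ) : energy (u j) = ENNReal.ofReal (‖u j‖ ^ 2) * energy (e j) := by
    simp only [hu, energy_sqrt_smul (h0 j), norm_sqrt_smul_sq (h0 j) (he.1 j)]
  have hfin (j : ℕ) (hj : u j ≠ 0) : energy (e j) ≠ ∞ := by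
    intro htop
    have h1 : energy (u j) ≤ ENNReal.ofReal M := (ENNReal.le_tsum j).trans h.tsum_energy_le
    rw [henergy, htop, ENNReal.mul_top] at h1
    · exact ENNReal.ofReal_ne_top (top_le_iff.1 h1)
    · rw [Ne, ENNReal.ofReal_eq_zero, not_le]
      positivity
  obtain ⟨f, hf, hfC⟩ := exists_injective_blocks (fun j => u j ≠ 0)
    (fun j => ⌊(energy (e j)).toReal⌋₊) C fun m s hs => by
      refine hC m e he s fun j hj => ?_
      rw [← ENNReal.ofReal_toReal (hfin j (hs j hj).1)]
      refine ENNReal.ofReal_le_ofReal ?_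
      rw [← (hs j hj).2]
      exact (Nat.lt_floor_add_one _).le
  refine ⟨_, h.extend hf, fun K p hp => ?_⟩
  by_cases hpf : ∃ j, f j = p
  · obtain ⟨j, rfl⟩ := hpf
    rw [hf.extend_apply, henergy, mul_comm]
    gcongr
    have hK : K ≤ ⌊(energy (e j)).toReal⌋₊ := by
      rw [mem_blocks, (hfC j).1] at hp
      by_contra! hlt
      exact hp ⟨hlt, (hfC j).2⟩
    rw [← ENNReal.ofReal_toReal (hfin j j.2), ← ENNReal.ofReal_natCast]
    exact ENNReal.ofReal_le_ofReal ((Nat.le_floor_iff ENNReal.toReal_nonneg).1 hK)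
  · simp [Function.extend_apply' _ _ _ hpf]

lemma mem_KM_of_equiv {κ : Type*} (σ : ℕ ≃ κ) {M : ℝ}
    {ρ : Lp ℂ 2 (volume : Measure ℝ) →L[ℂ] Lp ℂ 2 (volume : Measure ℝ)}
    {lam : κ → ℝ} {e : κ → Lp ℂ 2 (volume : Measure ℝ)} (h0 : ∀ k, 0 ≤ lam k)
    (he : Orthonormal ℂ e) (hkin : ∀ k, kinetic (e k) ≠ ∞)
    (h : IsEnergyDecomp M (fun k => (√(lam k) : ℂ) • e k) ρ) : ρ ∈ KM M := by
  choose g hg hgk using fun k => exists_hasWeakDeriv (hkin k)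
  refine ⟨lam ∘ σ, e ∘ σ, fun j => h0 _, he.comp _ σ.injective, ?_, ?_, fun j => e (σ j),
    fun j => g (σ j), fun j => Filter.EventuallyEq.rfl, fun j => hg _, ?_⟩
  · rw [σ.hasSum_iff]
    simpa only [norm_sqrt_smul_sq (h0 _) (he.1 _)] using h.hasSum_norm_sq
  · have := h.hasSum_rankOne
    simp only [rankOne_sqrt_smul (h0 _)] at this
    exact ((σ.hasSum_iff.2 this).tsum_eq).symm
  · refine le_trans ?_ h.tsum_energy_le
    rw [← σ.tsum_eq]
    refine ENNReal.tsum_le_tsum fun j => ?_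
    rw [energy_sqrt_smul (h0 _), energy]
    exact mul_le_mul_right (add_le_add_right (hgk _) _) _

namespace testFun

/-- Multiplication by the coordinate. -/
def mulCoord : testFun →ₗ[ℂ] testFun where
  toFun φ := ⟨fun x => (x : ℂ) * φ.1 x, Complex.ofRealCLM.contDiff.mul (testFun.contDiff φ),
    (testFun.hasCompactSupport φ).mul_left⟩
  map_add' φ ψ := by
    ext x
    exact mul_add _ _ _
  map_smul' c φ := by
    ext x
    exact mul_left_comm _ _ _

instance : Nontrivial testFun := by
  let b : ContDiffBump (0 : ℝ) := ⟨1, 2, one_pos, one_lt_two⟩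
  refine ⟨ofReal b b.contDiff b.hasCompactSupport, 0, fun h => ?_⟩
  have h0 := congrFun (congrArg Subtype.val h) 0
  have hb : b 0 = 1 := b.one_of_mem_closedBall (Metric.mem_closedBall_self b.rIn_pos.le)
  simp [ofReal, hb] at h0

lemma not_finiteDimensional : ¬ FiniteDimensional ℂ testFun := by
  intro _
  obtain ⟨c, hc⟩ := Module.End.exists_eigenvalue mulCoord
  obtain ⟨φ, hφ⟩ := hc.exists_hasEigenvector
  refine hφ.2 (Subtype.ext ?_)
  refine Continuous.ext_on (dense_compl_singleton c.re) (testFun.contDiff φ).continuous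
    continuous_const fun x hx => ?_
  have h : (x : ℂ) * φ.1 x = c * φ.1 x := congrFun (congrArg Subtype.val hφ.apply_eq_smul) x
  rcases mul_eq_mul_right_iff.1 h with h | h
  · exact absurd (congrArg Complex.re h) hx
  · exact h

lemma hasWeakDeriv (φ : testFun) : HasWeakDeriv φ (deriv φ) := by
  intro η hη hη'
  have hc : Continuous fun x => Complex.ofReal (η x) := Complex.continuous_ofReal.comp hη.continuous
  have hd : Continuous fun x => Complex.ofReal (deriv η x) :=
    Complex.continuous_ofReal.comp (hη.continuous_deriv (by simp))
  have hφ := (testFun.contDiff φ).continuous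
  have hφ' : Continuous (deriv φ.1) := (testFun.contDiff (derivative φ)).continuous
  refine integral_mul_deriv_eq_deriv_mul_of_integrable
    (fun x _ => (testFun.differentiable φ x).hasDerivAt)
    (fun x _ => ((hη.differentiable (by simp) x).hasDerivAt.ofReal_comp)) ?_ ?_ ?_
  · exact (hφ.mul hd).integrable_of_hasCompactSupport (testFun.hasCompactSupport φ).mul_right
  · exact (hφ'.mul hc).integrable_of_hasCompactSupport
      (testFun.hasCompactSupport (derivative φ)).mul_right
  · exact (hφ.mul hc).integrable_of_hasCompactSupport (testFun.hasCompactSupport φ).mul_right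

lemma kinetic_toL2_ne_top (φ : testFun) : kinetic (toL2 φ) ≠ ∞ := by
  refine ((kinetic_le_of_hasWeakDeriv (coeFn_toL2 φ) (hasWeakDeriv φ)).trans_lt ?_).ne
  have h := enorm_sq_Lp_two (toL2 (derivative φ))
  rw [lintegral_congr_ae (g := fun x => ENNReal.ofReal (‖deriv φ.1 x‖ ^ 2))] at h
  · rw [← h]
    exact ENNReal.ofReal_lt_top
  · filter_upwards [coeFn_toL2 (derivative φ)] with x hx
    rw [hx]
    rfl

end testFun

/-- Finitely many vectors of `L²` are orthogonal to some unit vector of finite kinetic energy. -/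
lemma exists_orthogonal_kinetic_ne_top (s : Finset (Lp ℂ 2 (volume : Measure ℝ))) :
    ∃ y : Lp ℂ 2 (volume : Measure ℝ), ‖y‖ = 1 ∧ kinetic y ≠ ∞ ∧ ∀ x ∈ s, inner ℂ x y = 0 := by
  let L : testFun →ₗ[ℂ] (s → ℂ) :=
    LinearMap.pi fun x => (innerSL ℂ x.1).toLinearMap ∘ₗ testFun.toL2
  have hL : ¬ Function.Injective L := fun h =>
    testFun.not_finiteDimensional (Module.Finite.of_injective L h)
  rw [injective_iff_map_eq_zero] at hL
  push Not at hL
  obtain ⟨φ, hφ, hφ0⟩ := hL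
  have hne : testFun.toL2 φ ≠ 0 := fun h => hφ0 (testFun.toL2_injective (by rw [h, map_zero]))
  refine ⟨((‖testFun.toL2 φ‖⁻¹ : ℝ) : ℂ) • testFun.toL2 φ, ?_, ?_, fun x hx => ?_⟩
  · rw [norm_smul, Complex.norm_real, norm_inv, norm_norm,
      inv_mul_cancel₀ (norm_ne_zero_iff.2 hne)]
  · rw [kinetic_smul]
    exact ENNReal.mul_ne_top ENNReal.ofReal_ne_top (testFun.kinetic_toL2_ne_top φ)
  · rw [inner_smul_right]
    have : inner ℂ x (testFun.toL2 φ) = 0 := congrFun hφ ⟨x, hx⟩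
    rw [this, mul_zero]

/-- A finite set of vectors is orthogonal to an orthonormal sequence of finite kinetic energy. -/
lemma exists_orthonormal_kinetic_ne_top (s : Finset (Lp ℂ 2 (volume : Measure ℝ))) :
    ∃ y : ℕ → Lp ℂ 2 (volume : Measure ℝ), Orthonormal ℂ y ∧ (∀ n, kinetic (y n) ≠ ∞) ∧
      ∀ x ∈ s, ∀ n, inner ℂ x (y n) = 0 := by
  classical
  have : Std.Symm fun x y : Lp ℂ 2 (volume : Measure ℝ) => inner ℂ x y = 0 :=
    ⟨fun _ _ h => inner_eq_zero_symm.1 h⟩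
  obtain ⟨y, hy, hyo⟩ := exists_seq_of_forall_finset_exists'
    (fun y : Lp ℂ 2 (volume : Measure ℝ) => ‖y‖ = 1 ∧ kinetic y ≠ ∞ ∧ ∀ x ∈ s, inner ℂ x y = 0)
    (fun x y => inner ℂ x y = 0) fun t _ => by
      obtain ⟨y, h1, h2, h3⟩ := exists_orthogonal_kinetic_ne_top (s ∪ t)
      exact ⟨y, ⟨h1, h2, fun x hx => h3 x (Finset.mem_union_left _ hx)⟩,
        fun x hx => h3 x (Finset.mem_union_right _ hx)⟩
  exact ⟨y, ⟨fun n => (hy n).1, hyo⟩, fun n => (hy n).2.1, fun x hx n => (hy n).2.2 x hx⟩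

lemma HasSum.sumElim_zero {ι κ α : Type*} [AddCommMonoid α] [TopologicalSpace α] [ContinuousAdd α]
    {f : ι ⊕ κ → α} {a : α} (h : HasSum (fun i => f (Sum.inl i)) a) (h0 : ∀ k, f (Sum.inr k) = 0) :
    HasSum f a := by
  have h1 : HasSum (f ∘ Sum.inr) 0 := by
    simpa only [Function.comp_def, h0] using hasSum_zero
  simpa only [add_zero] using HasSum.sum h h1

/-- Any decomposition of finite energy witnesses membership in `KM M`. -/
lemma IsEnergyDecomp.mem_KM {ι : Type*} [Countable ι] {M : ℝ}
    {v : ι → Lp ℂ 2 (volume : Measure ℝ)}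
    {ρ : Lp ℂ 2 (volume : Measure ℝ) →L[ℂ] Lp ℂ 2 (volume : Measure ℝ)}
    (h : IsEnergyDecomp M v ρ) : ρ ∈ KM M := by
  classical
  set e : {i // v i ≠ 0} → Lp ℂ 2 (volume : Measure ℝ) :=
    fun i => ((‖v i‖⁻¹ : ℝ) : ℂ) • v i with he
  have heo : Orthonormal ℂ e := by
    refine ⟨fun i => ?_, fun i j hij => ?_⟩
    · rw [he, norm_smul, Complex.norm_real, norm_inv, norm_norm,
        inv_mul_cancel₀ (norm_ne_zero_iff.2 i.2)]
    · simp only [he, inner_smul_left, inner_smul_right,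
        h.orthogonal fun hij' => hij (Subtype.ext hij'), mul_zero]
  have hkin (i) : kinetic (e i) ≠ ∞ := by
    rw [he, kinetic_smul]
    refine ENNReal.mul_ne_top ENNReal.ofReal_ne_top (ne_top_of_le_ne_top ENNReal.ofReal_ne_top
      (le_trans ?_ ((ENNReal.le_tsum i.1).trans h.tsum_energy_le)))
    exact le_add_self
  have hev (i : {i // v i ≠ 0}) : (√(‖v i‖ ^ 2) : ℂ) • e i = v i := by
    rw [Real.sqrt_sq (norm_nonneg _), he, smul_smul, ← Complex.ofReal_mul,
      mul_inv_cancel₀ (norm_ne_zero_iff.2 i.2), Complex.ofReal_one, one_smul]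
  have hinj : Function.Injective (id : {i // v i ≠ 0} → _) := Function.injective_id
  have hv : IsEnergyDecomp M (fun i : {i // v i ≠ 0} => v i) ρ := by
    have := h.extend hinj
    rwa [show Function.extend id (fun j : {i // v i ≠ 0} => v j) 0 =
      fun i : {i // v i ≠ 0} => v i from funext fun i => hinj.extend_apply _ _ i] at this
  cases finite_or_infinite {i // v i ≠ 0} with
  | inr _ =>
    obtain ⟨σ⟩ := nonempty_equiv_of_countable (α := ℕ) (β := {i // v i ≠ 0})
    refine mem_KM_of_equiv σ (fun i => sq_nonneg ‖v i‖) heo hkin ?_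
    simpa only [hev] using hv
  | inl _ =>
    obtain ⟨σ⟩ := nonempty_equiv_of_countable (α := ℕ) (β := {i // v i ≠ 0} ⊕ ℕ)
    have := Fintype.ofFinite {i // v i ≠ 0}
    obtain ⟨y, hy, hyk, hey⟩ := exists_orthonormal_kinetic_ne_top (Finset.univ.image e)
    have hey' (i n) : inner ℂ (e i) (y n) = 0 := hey _ (Finset.mem_image_of_mem e (by simp)) n
    have hext : (fun k => (√(Sum.elim (fun i : {i // v i ≠ 0} => ‖v i‖ ^ 2)
        (fun _ : ℕ => (0 : ℝ)) k) : ℂ) • Sum.elim e y k) = Sum.elim (fun i : {i // v i ≠ 0} => v i) 0 := by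
      funext k
      cases k with
      | inl i => exact hev i
      | inr n => simp
    refine mem_KM_of_equiv (lam := Sum.elim (fun i : {i // v i ≠ 0} => ‖v i‖ ^ 2) fun _ : ℕ => 0)
      (e := Sum.elim e y) σ ?_ ⟨?_, ?_⟩ ?_ ?_
    · rintro (i | n)
      · exact sq_nonneg _
      · exact le_rfl
    · rintro (i | n)
      · exact heo.1 i
      · exact hy.1 n
    · rintro (i | n) (j | m) hij
      · exact heo.2 fun h => hij (congrArg _ h)
      · exact hey' i m
      · exact inner_eq_zero_symm.1 (hey' j n)
      · exact hy.2 fun h => hij (congrArg _ h)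
    · rintro (i | n)
      · exact hkin i
      · exact hyk n
    · rw [hext]
      refine ⟨?_, HasSum.sumElim_zero hv.hasSum_norm_sq (by simp), ?_,
        HasSum.sumElim_zero hv.hasSum_rankOne fun _ => by ext; simp⟩
      · rintro (i | n) (j | m) hij
        · exact hv.orthogonal fun h => hij (congrArg _ h)
        all_goals simp
      · rw [(HasSum.sumElim_zero (f := fun k => energy (Sum.elim (fun i : {i // v i ≠ 0} => v i)
          (0 : ℕ → _) k)) ENNReal.summable.hasSum (by simp)).tsum_eq]
        exact hv.tsum_energy_le

lemma LowerSemicontinuous.le_of_tendsto {X : Type*} [TopologicalSpace X] {F : X → ℝ≥0∞}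
    (hF : LowerSemicontinuous F) {x : ℕ → X} {a : X} {c : ℝ≥0∞}
    (hx : Filter.Tendsto x Filter.atTop (nhds a)) (hc : ∀ n, F (x n) ≤ c) : F a ≤ c :=
  (lowerSemicontinuous_iff_isClosed_preimage.1 hF c).mem_of_tendsto hx
    (Filter.Eventually.of_forall hc)

lemma hasSum_of_tsum_ofReal_eq_one {ι : Type*} {f : ι → ℝ} (hf : ∀ i, 0 ≤ f i)
    (h : ∑' i, ENNReal.ofReal (f i) = 1) : HasSum f 1 := by
  have hne : ∑' i, ENNReal.ofReal (f i) ≠ ∞ := h ▸ ENNReal.one_ne_top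
  have hsum := ENNReal.hasSum_toReal hne
  rw [← ENNReal.tsum_toReal_eq fun i => ENNReal.ofReal_ne_top, h, ENNReal.toReal_one] at hsum
  simpa only [ENNReal.toReal_ofReal (hf _)] using hsum

lemma tsum_ite_add_sum {ι : Type*} [DecidableEq ι] (J : Finset ι) (f : ι → ℝ≥0∞) :
    ∑' i, f i = (∑' i, if i ∈ J then 0 else f i) + ∑ i ∈ J, f i := by
  have h : ∑ i ∈ J, f i = ∑' i, if i ∈ J then f i else 0 := by
    rw [tsum_eq_sum (s := J) fun i hi => if_neg hi]
    exact Finset.sum_congr rfl fun i hi => (if_pos hi).symm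
  rw [h, ← ENNReal.tsum_add]
  refine tsum_congr fun i => ?_
  split_ifs <;> simp

namespace IsEnergyDecomp

variable {ι : Type*} {M : ℝ} {v : ι → Lp ℂ 2 (volume : Measure ℝ)}
  {ρ : Lp ℂ 2 (volume : Measure ℝ) →L[ℂ] Lp ℂ 2 (volume : Measure ℝ)}

lemma tsum_norm_sq (h : IsEnergyDecomp M v ρ) : ∑' i, ENNReal.ofReal (‖v i‖ ^ 2) = 1 := by
  rw [← ENNReal.ofReal_tsum_of_nonneg (fun _ => sq_nonneg _) h.hasSum_norm_sq.summable,
    h.hasSum_norm_sq.tsum_eq, ENNReal.ofReal_one]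

lemma norm_le_one (h : IsEnergyDecomp M v ρ) (i : ι) : ‖v i‖ ≤ 1 :=
  (sq_le_one_iff₀ (norm_nonneg _)).1
    (le_hasSum h.hasSum_norm_sq i fun _ _ => sq_nonneg _)

lemma energy_le (h : IsEnergyDecomp M v ρ) (i : ι) : energy (v i) ≤ ENNReal.ofReal M :=
  (ENNReal.le_tsum i).trans h.tsum_energy_le

lemma tsum_tail_le [DecidableEq ι] (h : IsEnergyDecomp M v ρ) {J : Finset ι} {K : ℕ} (hK : K ≠ 0)
    (hJ : ∀ i ∉ J, K * ENNReal.ofReal (‖v i‖ ^ 2) ≤ energy (v i)) :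
    (∑' i, if i ∈ J then 0 else ENNReal.ofReal (‖v i‖ ^ 2)) ≤ ENNReal.ofReal M / K := by
  rw [ENNReal.le_div_iff_mul_le (by simp [hK]) (by simp), mul_comm, ← ENNReal.tsum_mul_left]
  refine le_trans (ENNReal.tsum_le_tsum fun i => ?_) h.tsum_energy_le
  split_ifs with hi
  · simp
  · exact hJ i hi

lemma schattenNorm_sub_sum_le [Countable ι] [DecidableEq ι] (h : IsEnergyDecomp M v ρ)
    (J : Finset ι) : schattenNorm 1 (ρ - ∑ i ∈ J, rankOne (v i) (v i)) ≤
      ∑' i, if i ∈ J then 0 else ENNReal.ofReal (‖v i‖ ^ 2) := by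
  refine (schattenNorm_one_le_of_orthogonal (u := fun i => if i ∈ J then 0 else v i) ?_ ?_).trans
    (ENNReal.tsum_le_tsum fun i => ?_)
  · intro i j hij
    split_ifs
    · exact inner_zero_left _
    · exact inner_zero_left _
    · exact inner_zero_right _
    · exact h.orthogonal hij
  · have hJ : HasSum (fun i => if i ∈ J then rankOne (v i) (v i) else 0)
        (∑ i ∈ J, rankOne (v i) (v i)) := by
      rw [← Finset.sum_congr rfl fun i hi => if_pos hi]
      exact hasSum_sum_of_ne_finset_zero fun i hi => if_neg hi
    have heq (i : ι) : rankOne (if i ∈ J then 0 else v i) (if i ∈ J then 0 else v i) =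
        rankOne (v i) (v i) - if i ∈ J then rankOne (v i) (v i) else 0 := by
      split_ifs
      · rw [sub_self]
        ext
        simp
      · rw [sub_zero]
    simpa only [heq] using h.hasSum_rankOne.sub hJ
  · split_ifs <;> simp

end IsEnergyDecomp

/-- Pointwise limits of energy decompositions with uniformly small tails are again energy
decompositions. -/
lemma exists_isEnergyDecomp_of_tendsto {M : ℝ} {J : ℕ → Finset (ℕ × ℕ)}
    {v : ℕ → ℕ × ℕ → Lp ℂ 2 (volume : Measure ℝ)} {w : ℕ × ℕ → Lp ℂ 2 (volume : Measure ℝ)}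
    {ρ : ℕ → Lp ℂ 2 (volume : Measure ℝ) →L[ℂ] Lp ℂ 2 (volume : Measure ℝ)}
    (h : ∀ n, IsEnergyDecomp M (v n) (ρ n))
    (htail : ∀ K ≠ 0, ∀ n, (∑' p, if p ∈ J K then 0 else ENNReal.ofReal (‖v n p‖ ^ 2)) ≤
      ENNReal.ofReal M / K)
    (hvw : Filter.Tendsto v Filter.atTop (nhds w)) :
    (∃ ρ, IsEnergyDecomp M w ρ) ∧ ∀ K ≠ 0,
      (∑' p, if p ∈ J K then 0 else ENNReal.ofReal (‖w p‖ ^ 2)) ≤ ENNReal.ofReal M / K := by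
  have hcont (p : ℕ × ℕ) : Continuous fun u : ℕ × ℕ → Lp ℂ 2 (volume : Measure ℝ) =>
      ENNReal.ofReal (‖u p‖ ^ 2) :=
    ENNReal.continuous_ofReal.comp ((continuous_apply p).norm.pow 2)
  have hle : ∑' p, ENNReal.ofReal (‖w p‖ ^ 2) ≤ 1 :=
    (lowerSemicontinuous_tsum fun p => (hcont p).lowerSemicontinuous).le_of_tendsto hvw
      fun n => (h n).tsum_norm_sq.le
  have hge (K : ℕ) (hK : K ≠ 0) :
      1 ≤ ENNReal.ofReal M / K + ∑' p, ENNReal.ofReal (‖w p‖ ^ 2) := by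
    refine le_trans ?_ (add_le_add_right (ENNReal.sum_le_tsum (J K)) _)
    refine ge_of_tendsto (tendsto_const_nhds.add
      (tendsto_finsetSum _ fun p _ => ((hcont p).tendsto w).comp hvw))
      (Filter.Eventually.of_forall fun n => ?_)
    rw [← (h n).tsum_norm_sq, tsum_ite_add_sum (J K)]
    exact add_le_add_left (htail K hK n) _
  have hone : ∑' p, ENNReal.ofReal (‖w p‖ ^ 2) = 1 := by
    refine le_antisymm hle ?_
    have hlim := (ENNReal.Tendsto.const_mul (a := ENNReal.ofReal M)
      ENNReal.tendsto_inv_nat_nhds_zero (Or.inr ENNReal.ofReal_ne_top)).add_const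
      (∑' p, ENNReal.ofReal (‖w p‖ ^ 2))
    rw [mul_zero, zero_add] at hlim
    refine ge_of_tendsto hlim ?_
    filter_upwards [Filter.eventually_ne_atTop 0] with K hK using hge K hK
  have hsum := hasSum_of_tsum_ofReal_eq_one (fun p => sq_nonneg ‖w p‖) hone
  have hrank : Summable fun p => rankOne (w p) (w p) := by
    refine Summable.of_norm ?_
    simpa only [norm_rankOne, ← sq] using hsum.summable
  refine ⟨⟨_, fun p q hpq => ?_, hsum, ?_, hrank.hasSum⟩, fun K hK => ?_⟩
  · refine tendsto_nhds_unique (((tendsto_pi_nhds.1 hvw p).inner (tendsto_pi_nhds.1 hvw q))) ?_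
    simp only [(h _).orthogonal hpq, tendsto_const_nhds]
  · exact (lowerSemicontinuous_tsum fun p =>
      lowerSemicontinuous_energy.comp (continuous_apply p)).le_of_tendsto hvw
      fun n => (h n).tsum_energy_le
  · refine LowerSemicontinuous.le_of_tendsto (F := fun u : ℕ × ℕ → Lp ℂ 2 (volume : Measure ℝ) =>
      ∑' p, if p ∈ J K then 0 else ENNReal.ofReal (‖u p‖ ^ 2))
      (lowerSemicontinuous_tsum fun p => ?_) hvw (htail K hK)
    split_ifs
    · exact continuous_const.lowerSemicontinuous
    · exact (hcont p).lowerSemicontinuous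

lemma schattenNorm_sub_le_of_isEnergyDecomp {ι : Type*} [Countable ι] [DecidableEq ι] {M : ℝ}
    {v w : ι → Lp ℂ 2 (volume : Measure ℝ)}
    {ρ τ : Lp ℂ 2 (volume : Measure ℝ) →L[ℂ] Lp ℂ 2 (volume : Measure ℝ)}
    (hv : IsEnergyDecomp M v ρ) (hw : IsEnergyDecomp M w τ) (J : Finset ι) :
    schattenNorm 1 (ρ - τ) ≤ 2 * ((J.card * 2 : ℕ) * ENNReal.ofReal
        ‖∑ i ∈ J, (rankOne (v i) (v i) - rankOne (w i) (w i))‖ +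
      2 * ((∑' i, if i ∈ J then 0 else ENNReal.ofReal (‖w i‖ ^ 2)) +
        ∑' i, if i ∈ J then 0 else ENNReal.ofReal (‖v i‖ ^ 2))) := by
  have hdecomp : ρ - τ = (∑ i ∈ J, (rankOne (v i) (v i) - rankOne (w i) (w i))) -
      ((τ - ∑ i ∈ J, rankOne (w i) (w i)) - (ρ - ∑ i ∈ J, rankOne (v i) (v i))) := by
    rw [Finset.sum_sub_distrib]
    abel
  rw [hdecomp]
  refine (schattenNorm_one_sub_le _ _).trans ?_
  gcongr
  · refine schattenNorm_one_le_of_rank_le _ (rank_sum_le _ _ _ fun i _ => ?_)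
    exact rank_sub_le (m := 1) (n := 1) (by simpa using rank_rankOne_le _ _)
      (by simpa using rank_rankOne_le _ _)
  · refine (schattenNorm_one_sub_le _ _).trans ?_
    gcongr
    · exact hw.schattenNorm_sub_sum_le J
    · exact hv.schattenNorm_sub_sum_le J

/-- For every `M > 0`, the set `K_M` is compact for the trace-class norm: every
sequence in `K_M` admits a subsequence converging in Schatten `1`-norm to an
element of `K_M`. -/
theorem isCompact_KM (M : ℝ) (hM : 0 < M)
    (ρseq : ℕ → (Lp ℂ 2 (volume : Measure ℝ) →L[ℂ] Lp ℂ 2 (volume : Measure ℝ)))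
    (hseq : ∀ n, ρseq n ∈ KM M) :
    ∃ σ : ℕ → ℕ, StrictMono σ ∧ ∃ ρ ∈ KM M,
      Filter.Tendsto (fun n => schattenNorm 1 (ρseq (σ n) - ρ))
        Filter.atTop (nhds 0) := by
  obtain ⟨C, hC⟩ := exists_uniform_isEnergyDecomp M
  choose v hv hvC using fun n => hC (ρseq n) (hseq n)
  obtain ⟨w, -, σ, hσ, hlim⟩ :=
    (isCompact_univ_pi fun _ : ℕ × ℕ => isCompact_energy_le M hM.le).tendsto_subseq
      (x := v) fun n p _ => ⟨(hv n).norm_le_one p, (hv n).energy_le p⟩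
  have htail (K : ℕ) (hK : K ≠ 0) (n : ℕ) :
      (∑' p, if p ∈ blocks C K then 0 else ENNReal.ofReal (‖v (σ n) p‖ ^ 2)) ≤
        ENNReal.ofReal M / K := (hv (σ n)).tsum_tail_le hK (hvC (σ n) K)
  obtain ⟨⟨ρ, hρ⟩, hwtail⟩ := exists_isEnergyDecomp_of_tendsto (fun n => hv (σ n)) htail hlim
  refine ⟨σ, hσ, ρ, hρ.mem_KM, ENNReal.tendsto_nhds_zero.2 fun ε hε => ?_⟩
  have hdiv : Filter.Tendsto (fun K : ℕ => ENNReal.ofReal M / K) Filter.atTop (nhds 0) := by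
    simpa only [mul_zero, div_eq_mul_inv] using ENNReal.Tendsto.const_mul (a := ENNReal.ofReal M)
      ENNReal.tendsto_inv_nat_nhds_zero (Or.inr ENNReal.ofReal_ne_top)
  have hK : Filter.Tendsto
      (fun K : ℕ => 2 * (0 + 2 * (ENNReal.ofReal M / K + ENNReal.ofReal M / K)))
      Filter.atTop (nhds 0) := by
    simpa only [mul_zero, zero_add] using ENNReal.Tendsto.const_mul (a := 2)
      (ENNReal.Tendsto.const_mul (a := 2) (hdiv.add hdiv) (Or.inr (by simp))) (Or.inr (by simp))
  obtain ⟨K, hKε, hK0⟩ := ((hK.eventually_lt_const hε).and (Filter.eventually_ne_atTop 0)).exists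
  have hH : Filter.Tendsto (fun n => ENNReal.ofReal ‖∑ p ∈ blocks C K,
      (rankOne (v (σ n) p) (v (σ n) p) - rankOne (w p) (w p))‖) Filter.atTop (nhds 0) := by
    rw [← ENNReal.ofReal_zero]
    refine ENNReal.tendsto_ofReal (tendsto_zero_iff_norm_tendsto_zero.1 ?_)
    have h0 := tendsto_finsetSum (blocks C K) fun p _ =>
      ((continuous_rankOne_self.tendsto (w p)).comp (tendsto_pi_nhds.1 hlim p)).sub_const
        (rankOne (w p) (w p))
    simpa only [sub_self, Finset.sum_const_zero, Function.comp_apply] using h0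
  have hbound : Filter.Tendsto (fun n => 2 * (((blocks C K).card * 2 : ℕ) * ENNReal.ofReal
      ‖∑ p ∈ blocks C K, (rankOne (v (σ n) p) (v (σ n) p) - rankOne (w p) (w p))‖ +
      2 * (ENNReal.ofReal M / K + ENNReal.ofReal M / K))) Filter.atTop
      (nhds (2 * (0 + 2 * (ENNReal.ofReal M / K + ENNReal.ofReal M / K)))) := by
    refine ENNReal.Tendsto.const_mul (Filter.Tendsto.add_const _ ?_) (Or.inr (by simp))
    simpa only [mul_zero] using ENNReal.Tendsto.const_mul hH (Or.inr (ENNReal.natCast_ne_top _))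
  filter_upwards [hbound.eventually_lt_const hKε] with n hn
  refine ((schattenNorm_sub_le_of_isEnergyDecomp (hv (σ n)) hρ (blocks C K)).trans ?_).trans hn.le
  gcongr
  · exact hwtail K hK0
  · exact htail K hK0 n
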